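/- arXiv:2510.22481 — 6 statements merged into one kernel-verified Lean document; each statement's English description precedes it below -/
import Mathlib

section
/- Let N ≥ 2, let μ be the Haar probability measure on the unitary group U(N), let ψ₀ ∈ ℂ^N be a unit vector, and let X be an N×N Hermitian matrix with Tr X = 0 and X² = I. Then ∫_{U(N)} ⟨ψ₀, U*XU ψ₀⟩² dμ(U) = 1/(N+1). Consequently, the Haar average of the diagonal Fubini–Study metric element g_{ℓℓ}(U) = ⟨ψ₀, U*X²U ψ₀⟩ − ⟨ψ₀, U*XU ψ₀⟩² equals N/(N+1). -/
open MeasureTheory Matrix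

namespace HaarSecondMoment

instance compactSpace_unitaryGroup {n : Type*} [Fintype n] [DecidableEq n] :
    CompactSpace (Matrix.unitaryGroup n ℂ) := by
  refine isCompact_iff_compactSpace.mp ?_
  have hbox : IsCompact {A : Matrix n n ℂ | ∀ i j, A i j ∈ Metric.closedBall (0 : ℂ) 1} := by
    have heq : {A : Matrix n n ℂ | ∀ i j, A i j ∈ Metric.closedBall (0 : ℂ) 1}
        = Set.pi Set.univ fun _ : n => Set.pi Set.univ fun _ : n => Metric.closedBall (0 : ℂ) 1 :=
      Set.ext fun _ => ⟨fun h i _ j _ => h i j, fun h i j => h i trivial j trivial⟩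
    rw [heq]
    exact isCompact_univ_pi fun _ => isCompact_univ_pi fun _ => isCompact_closedBall _ _
  refine hbox.of_isClosed_subset (isClosed_unitary (R := Matrix n n ℂ)) fun A hA i j => ?_
  simpa using entry_norm_bound_of_unitary hA i j

section Unitary

variable {n : Type*} [Fintype n] [DecidableEq n]

/-- The rank-one perturbation `1 + c • u uᴴ` of the identity is unitary as soon as
`c + c̄ + ⟨u, u⟩ c c̄ = 0`. -/
theorem one_add_smul_vecMulVec_mem_unitaryGroup (u : n → ℂ) (c : ℂ)
    (hc : c + star c + (star u ⬝ᵥ u) * (c * star c) = 0) :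
    1 + c • vecMulVec u (star u) ∈ Matrix.unitaryGroup n ℂ := by
  rw [Matrix.mem_unitaryGroup_iff]
  have hP : star (vecMulVec u (star u)) = vecMulVec u (star u) := by
    ext i j
    simp [vecMulVec_apply, mul_comm]
  have hPP : vecMulVec u (star u) * vecMulVec u (star u)
      = (star u ⬝ᵥ u) • vecMulVec u (star u) := by
    rw [vecMulVec_mul_vecMulVec]
    ext i j
    simp [vecMulVec_apply]
    ring
  rw [star_add, star_one, star_smul, hP, add_mul, mul_add, mul_add, one_mul, one_mul, mul_one,
    smul_mul_smul_comm, hPP, smul_smul, add_assoc, ← add_smul, ← add_smul]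
  rw [show star c + (c + c * star c * (star u ⬝ᵥ u)) = 0 by rw [← hc]; ring, zero_smul, add_zero]

theorem exists_unitary_pair {i k : n} (hik : i ≠ k) (ω c : ℂ) (hω : star ω * ω = 1)
    (hc : c + star c + 2 * (c * star c) = 0) :
    ∃ V : Matrix.unitaryGroup n ℂ, ∀ v : n → ℂ,
      ((V : Matrix n n ℂ) *ᵥ v) i = v i + c * (v i + star ω * v k) ∧
      ((V : Matrix n n ℂ) *ᵥ v) k = v k + c * (v i + star ω * v k) * ω := by
  set u : n → ℂ := Pi.single i 1 + Pi.single k ω with hu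
  have hdot (v : n → ℂ) : star u ⬝ᵥ v = v i + star ω * v k := by
    simp [hu, star_add, Pi.star_single, add_dotProduct]
  have hui : u i = 1 := by simp [hu, hik]
  have huk : u k = ω := by simp [hu, hik.symm]
  refine ⟨⟨1 + c • vecMulVec u (star u),
    one_add_smul_vecMulVec_mem_unitaryGroup u c ?_⟩, fun v => ?_⟩
  · rw [hdot, hui, huk, hω, ← hc]
    ring
  · simp only [add_mulVec, one_mulVec, smul_mulVec, vecMulVec_mulVec, hdot, Pi.add_apply,
      Pi.smul_apply, hui, huk, smul_eq_mul, MulOpposite.smul_eq_mul_unop, MulOpposite.unop_op]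
    constructor <;> ring

theorem star_mulVec_dotProduct_mulVec (ψ : n → ℂ) (U : Matrix.unitaryGroup n ℂ) (A : Matrix n n ℂ) :
    star ψ ⬝ᵥ (((U : Matrix n n ℂ)ᴴ * A * (U : Matrix n n ℂ)) *ᵥ ψ)
      = star ((U : Matrix n n ℂ) *ᵥ ψ) ⬝ᵥ (A *ᵥ ((U : Matrix n n ℂ) *ᵥ ψ)) := by
  rw [star_mulVec, ← dotProduct_mulVec, mulVec_mulVec, mulVec_mulVec, Matrix.mul_assoc]

theorem sum_normSq_mulVec {ψ : n → ℂ} (hψ : star ψ ⬝ᵥ ψ = 1) (U : Matrix.unitaryGroup n ℂ) :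
    ∑ i, Complex.normSq (((U : Matrix n n ℂ) *ᵥ ψ) i) = 1 := by
  have h := star_mulVec_dotProduct_mulVec ψ U 1
  rw [Matrix.mul_one, ← star_eq_conjTranspose, Unitary.coe_star_mul_self, one_mulVec, one_mulVec,
    hψ] at h
  have h' : ((∑ i, Complex.normSq (((U : Matrix n n ℂ) *ᵥ ψ) i) : ℝ) : ℂ) = 1 := by
    rw [h, dotProduct, Complex.ofReal_sum]
    refine Finset.sum_congr rfl fun i _ => ?_
    rw [Complex.normSq_eq_conj_mul_self]
    rfl
  exact_mod_cast h'

end Unitary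

section Moments

variable {n : Type*} [Fintype n] [DecidableEq n]
  [MeasurableSpace (Matrix.unitaryGroup n ℂ)] [BorelSpace (Matrix.unitaryGroup n ℂ)]
  (μ : Measure (Matrix.unitaryGroup n ℂ)) (ψ : n → ℂ)

theorem integrable_comp_mulVec [IsFiniteMeasure μ] {g : (n → ℂ) → ℝ} (hg : Continuous g) :
    Integrable (fun U : Matrix.unitaryGroup n ℂ => g ((U : Matrix n n ℂ) *ᵥ ψ)) μ := by
  refine Continuous.integrable_of_hasCompactSupport ?_ (HasCompactSupport.of_compactSpace _)
  exact hg.comp (continuous_subtype_val.matrix_mulVec continuous_const)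

theorem integral_comp_unitary_mulVec [μ.IsMulLeftInvariant] (g : (n → ℂ) → ℝ)
    (V : Matrix.unitaryGroup n ℂ) :
    ∫ U : Matrix.unitaryGroup n ℂ, g ((V : Matrix n n ℂ) *ᵥ ((U : Matrix n n ℂ) *ᵥ ψ)) ∂μ
      = ∫ U : Matrix.unitaryGroup n ℂ, g ((U : Matrix n n ℂ) *ᵥ ψ) ∂μ := by
  rw [← integral_mul_left_eq_self (fun U : Matrix.unitaryGroup n ℂ =>
    g ((U : Matrix n n ℂ) *ᵥ ψ)) V]
  simp only [Submonoid.coe_mul, mulVec_mulVec]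

/-- The fourth moment `∫ |(Uψ)ᵢ|² |(Uψ)ₖ|² dμ(U)`. -/
noncomputable def fourthMoment (i k : n) : ℝ :=
  ∫ U : Matrix.unitaryGroup n ℂ, Complex.normSq (((U : Matrix n n ℂ) *ᵥ ψ) i) *
    Complex.normSq (((U : Matrix n n ℂ) *ᵥ ψ) k) ∂μ

theorem fourthMoment_self_eq [μ.IsMulLeftInvariant] (i k : n) :
    fourthMoment μ ψ i i = fourthMoment μ ψ k k := by
  rcases eq_or_ne i k with rfl | hik
  · rfl
  obtain ⟨V, hV⟩ := exists_unitary_pair hik 1 (-1) (by simp) (by norm_num)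
  have h := integral_comp_unitary_mulVec μ ψ
    (fun v => Complex.normSq (v k) * Complex.normSq (v k)) V
  simp only [(hV _).2] at h
  rw [fourthMoment, fourthMoment, ← h]
  congr 1
  ext U
  simp

theorem two_mul_fourthMoment_of_ne [IsFiniteMeasure μ] [μ.IsMulLeftInvariant] {i k : n}
    (hik : i ≠ k) :
    2 * fourthMoment μ ψ i k = fourthMoment μ ψ i i := by
  have hc : (Complex.I - 1) / 2 + star ((Complex.I - 1) / 2)
      + 2 * ((Complex.I - 1) / 2 * star ((Complex.I - 1) / 2)) = 0 := by
    apply Complex.ext <;> simp <;> norm_num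
  obtain ⟨V, hV⟩ := exists_unitary_pair hik 1 ((Complex.I - 1) / 2) (by simp) hc
  obtain ⟨W, hW⟩ := exists_unitary_pair hik Complex.I ((Complex.I - 1) / 2) (by simp) hc
  set g : (n → ℂ) → ℝ := fun v => (Complex.normSq (v i) - Complex.normSq (v k)) ^ 2 with hg
  have hgc : Continuous g := by fun_prop
  have hgV := integral_comp_unitary_mulVec μ ψ g V
  have hgW := integral_comp_unitary_mulVec μ ψ g W
  have hint (j l : n) : Integrable (fun U : Matrix.unitaryGroup n ℂ =>
      Complex.normSq (((U : Matrix n n ℂ) *ᵥ ψ) j) *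
        Complex.normSq (((U : Matrix n n ℂ) *ᵥ ψ) l)) μ :=
    integrable_comp_mulVec μ ψ (g := fun v => Complex.normSq (v j) * Complex.normSq (v l))
      (by fun_prop)
  have hpt (v : n → ℂ) : g ((V : Matrix n n ℂ) *ᵥ v) + g ((W : Matrix n n ℂ) *ᵥ v)
      = 4 * (Complex.normSq (v i) * Complex.normSq (v k)) := by
    simp only [hg, (hV v).1, (hV v).2, (hW v).1, (hW v).2, Complex.normSq_apply]
    simp
    ring
  have hsum : (∫ U : Matrix.unitaryGroup n ℂ, g ((U : Matrix n n ℂ) *ᵥ ψ) ∂μ)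
      + (∫ U : Matrix.unitaryGroup n ℂ, g ((U : Matrix n n ℂ) *ᵥ ψ) ∂μ)
      = 4 * fourthMoment μ ψ i k := by
    nth_rewrite 1 [← hgV]
    rw [← hgW, ← integral_add, fourthMoment, ← integral_const_mul]
    · simp only [hpt]
    · exact integrable_comp_mulVec μ ψ (g := fun v => g ((V : Matrix n n ℂ) *ᵥ v))
        (hgc.comp (continuous_const.matrix_mulVec continuous_id))
    · exact integrable_comp_mulVec μ ψ (g := fun v => g ((W : Matrix n n ℂ) *ᵥ v))
        (hgc.comp (continuous_const.matrix_mulVec continuous_id))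
  have hexp : (∫ U : Matrix.unitaryGroup n ℂ, g ((U : Matrix n n ℂ) *ᵥ ψ) ∂μ)
      = fourthMoment μ ψ i i + fourthMoment μ ψ k k - 2 * fourthMoment μ ψ i k := by
    simp only [fourthMoment]
    rw [← integral_const_mul, ← integral_add (hint i i) (hint k k),
      ← integral_sub (by exact (hint i i).add (hint k k)) ((hint i k).const_mul 2)]
    congr 1
    ext U
    simp only [hg]
    ring
  have hself := fourthMoment_self_eq μ ψ i k
  linarith

theorem integral_sum_mul_normSq_sq [IsFiniteMeasure μ] (d : n → ℝ) :
    ∫ U : Matrix.unitaryGroup n ℂ,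
        (∑ i, d i * Complex.normSq (((U : Matrix n n ℂ) *ᵥ ψ) i)) ^ 2 ∂μ
      = ∑ i, ∑ k, d i * d k * fourthMoment μ ψ i k := by
  have hint (j l : n) : Integrable (fun U : Matrix.unitaryGroup n ℂ =>
      d j * d l * (Complex.normSq (((U : Matrix n n ℂ) *ᵥ ψ) j) *
        Complex.normSq (((U : Matrix n n ℂ) *ᵥ ψ) l))) μ :=
    integrable_comp_mulVec μ ψ
      (g := fun v => d j * d l * (Complex.normSq (v j) * Complex.normSq (v l))) (by fun_prop)
  simp only [fourthMoment, ← integral_const_mul]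
  simp_rw [← integral_finsetSum _ fun k _ => hint _ k]
  rw [← integral_finsetSum _ fun i _ => integrable_finsetSum _ fun k _ => hint i k]
  congr 1
  ext U
  rw [sq, Finset.sum_mul_sum]
  exact Finset.sum_congr rfl fun i _ => Finset.sum_congr rfl fun k _ => by ring

theorem sum_mul_fourthMoment [IsFiniteMeasure μ] [μ.IsMulLeftInvariant] (d : n → ℝ) (j : n) :
    ∑ i, ∑ k, d i * d k * fourthMoment μ ψ i k
      = fourthMoment μ ψ j j / 2 * ((∑ i, d i) ^ 2 + ∑ i, d i ^ 2) := by
  have hm (i k : n) : fourthMoment μ ψ i k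
      = fourthMoment μ ψ j j / 2 * (1 + if i = k then 1 else 0) := by
    split_ifs with h
    · rw [h, fourthMoment_self_eq μ ψ k j]
      ring
    · rw [← fourthMoment_self_eq μ ψ i j, ← two_mul_fourthMoment_of_ne μ ψ h]
      ring
  have hterm (i k : n) : d i * d k * fourthMoment μ ψ i k
      = fourthMoment μ ψ j j / 2 * (d i * d k + if i = k then d i * d k else 0) := by
    rw [hm]
    split_ifs <;> ring
  simp only [hterm, ← Finset.mul_sum, Finset.sum_add_distrib]
  rw [sq (∑ i, d i), Finset.sum_mul]
  simp [sq]

/-- Second moment of a diagonal quadratic form at a Haar-random unit vector. -/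
theorem integral_sum_mul_normSq_sq_eq [IsProbabilityMeasure μ] [μ.IsMulLeftInvariant]
    (hψ : star ψ ⬝ᵥ ψ = 1) (d : n → ℝ) :
    ∫ U : Matrix.unitaryGroup n ℂ,
        (∑ i, d i * Complex.normSq (((U : Matrix n n ℂ) *ᵥ ψ) i)) ^ 2 ∂μ
      = ((∑ i, d i) ^ 2 + ∑ i, d i ^ 2) / (Fintype.card n * (Fintype.card n + 1)) := by
  obtain ⟨j⟩ : Nonempty n := by
    by_contra h
    rw [not_nonempty_iff] at h
    simp [dotProduct] at hψ
  have hone := integral_sum_mul_normSq_sq μ ψ fun _ => 1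
  rw [sum_mul_fourthMoment μ ψ _ j] at hone
  simp only [one_mul, sum_normSq_mulVec hψ] at hone
  simp at hone
  have hcard : (0 : ℝ) < Fintype.card n := by
    exact_mod_cast Fintype.card_pos_iff.mpr ⟨j⟩
  rw [integral_sum_mul_normSq_sq, sum_mul_fourthMoment μ ψ d j]
  rw [eq_div_iff (by positivity)]
  linear_combination -((∑ i, d i) ^ 2 + ∑ i, d i ^ 2) * hone

end Moments

section Hermitian

variable {n : Type*} [Fintype n] [DecidableEq n] {X : Matrix n n ℂ}

theorem star_dotProduct_mulVec_eq_sum_eigenvalues (hX : X.IsHermitian) (v : n → ℂ) :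
    star v ⬝ᵥ (X *ᵥ v) = ((∑ i, hX.eigenvalues i * Complex.normSq
      ((((star hX.eigenvectorUnitary : Matrix.unitaryGroup n ℂ) : Matrix n n ℂ) *ᵥ v) i) : ℝ) :
        ℂ) := by
  have h := hX.spectral_theorem
  rw [Unitary.conjStarAlgAut_apply] at h
  have h2 := star_mulVec_dotProduct_mulVec v (star hX.eigenvectorUnitary)
    (diagonal (RCLike.ofReal ∘ hX.eigenvalues))
  rw [← star_eq_conjTranspose, Unitary.coe_star, star_star, ← h] at h2
  rw [h2, dotProduct, Complex.ofReal_sum]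
  refine Finset.sum_congr rfl fun i _ => ?_
  rw [Complex.ofReal_mul, Complex.normSq_eq_conj_mul_self, mulVec_diagonal]
  simp
  ring

theorem sum_eigenvalues_sq (hX : X.IsHermitian) :
    ((∑ i, hX.eigenvalues i ^ 2 : ℝ) : ℂ) = (X * X).trace := by
  have h := hX.spectral_theorem
  conv_rhs => rw [h, ← map_mul, Unitary.conjStarAlgAut_apply, Matrix.trace_mul_cycle,
    Unitary.coe_star_mul_self, Matrix.one_mul, diagonal_mul_diagonal, trace_diagonal]
  simp [sq]

end Hermitian

/-- Second moment of the expectation value of a Hermitian matrix at a Haar-random unit vector. -/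
theorem integrable_and_integral_quadraticForm_sq {n : Type*} [Fintype n] [DecidableEq n]
    [MeasurableSpace (Matrix.unitaryGroup n ℂ)] [BorelSpace (Matrix.unitaryGroup n ℂ)]
    (μ : Measure (Matrix.unitaryGroup n ℂ)) [IsProbabilityMeasure μ] [μ.IsMulLeftInvariant]
    {ψ : n → ℂ} (hψ : star ψ ⬝ᵥ ψ = 1) {X : Matrix n n ℂ} (hX : X.IsHermitian) :
    Integrable (fun U : Matrix.unitaryGroup n ℂ =>
      (star ψ ⬝ᵥ (((U : Matrix n n ℂ)ᴴ * X * (U : Matrix n n ℂ)) *ᵥ ψ)) ^ 2) μ ∧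
    ∫ U : Matrix.unitaryGroup n ℂ,
      (star ψ ⬝ᵥ (((U : Matrix n n ℂ)ᴴ * X * (U : Matrix n n ℂ)) *ᵥ ψ)) ^ 2 ∂μ
      = (X.trace ^ 2 + (X * X).trace) / (Fintype.card n * (Fintype.card n + 1)) := by
  set g : (n → ℂ) → ℝ := fun w => (∑ i, hX.eigenvalues i * Complex.normSq (w i)) ^ 2 with hg
  have hpt (U : Matrix.unitaryGroup n ℂ) :
      (star ψ ⬝ᵥ (((U : Matrix n n ℂ)ᴴ * X * (U : Matrix n n ℂ)) *ᵥ ψ)) ^ 2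
      = ((g (((star hX.eigenvectorUnitary : Matrix.unitaryGroup n ℂ) : Matrix n n ℂ) *ᵥ
          ((U : Matrix n n ℂ) *ᵥ ψ)) : ℝ) : ℂ) := by
    rw [star_mulVec_dotProduct_mulVec, star_dotProduct_mulVec_eq_sum_eigenvalues hX]
    simp [hg]
  simp only [hpt]
  have hgc : Continuous g := by fun_prop
  refine ⟨(integrable_comp_mulVec μ ψ (hgc.comp
    (continuous_const.matrix_mulVec continuous_id))).ofReal, ?_⟩
  rw [integral_complex_ofReal, integral_comp_unitary_mulVec, integral_sum_mul_normSq_sq_eq μ ψ hψ,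
    ← sum_eigenvalues_sq hX, hX.trace_eq_sum_eigenvalues]
  simp

end HaarSecondMoment

/-- **Haar second moment and average diagonal Fubini–Study metric element.**
For Haar probability measure `μ` on `U(N)` with `N ≥ 2`, a unit vector `ψ₀ ∈ ℂ^N` and a
Hermitian matrix `X` with `Tr X = 0` and `X² = I`, one has
`∫ ⟨ψ₀, U*XU ψ₀⟩² dμ = 1/(N+1)`, hence the Haar average of the diagonal Fubini–Study metric
element `g_{ℓℓ}(U) = ⟨ψ₀, U*X²U ψ₀⟩ - ⟨ψ₀, U*XU ψ₀⟩²` equals `N/(N+1)`. -/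
theorem haar_average_diagonal_fubini_study
    {N : ℕ} (hN : 2 ≤ N)
    [MeasurableSpace (Matrix.unitaryGroup (Fin N) ℂ)]
    [BorelSpace (Matrix.unitaryGroup (Fin N) ℂ)]
    (μ : Measure (Matrix.unitaryGroup (Fin N) ℂ))
    [μ.IsHaarMeasure] [IsProbabilityMeasure μ]
    (ψ₀ : Fin N → ℂ) (hψ₀ : star ψ₀ ⬝ᵥ ψ₀ = 1)
    (X : Matrix (Fin N) (Fin N) ℂ) (hX : X.IsHermitian) (htr : X.trace = 0)
    (hX2 : X * X = 1) :
    (∫ U : Matrix.unitaryGroup (Fin N) ℂ,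
        (star ψ₀ ⬝ᵥ (((U : Matrix (Fin N) (Fin N) ℂ)ᴴ * X *
          (U : Matrix (Fin N) (Fin N) ℂ)).mulVec ψ₀)) ^ 2 ∂μ) = 1 / ((N : ℂ) + 1) ∧
      (∫ U : Matrix.unitaryGroup (Fin N) ℂ,
        (star ψ₀ ⬝ᵥ (((U : Matrix (Fin N) (Fin N) ℂ)ᴴ * (X * X) *
            (U : Matrix (Fin N) (Fin N) ℂ)).mulVec ψ₀))
          - (star ψ₀ ⬝ᵥ (((U : Matrix (Fin N) (Fin N) ℂ)ᴴ * X *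
            (U : Matrix (Fin N) (Fin N) ℂ)).mulVec ψ₀)) ^ 2 ∂μ)
        = (N : ℂ) / ((N : ℂ) + 1) := by
  have hN0 : (N : ℂ) ≠ 0 := by
    exact_mod_cast (by omega : N ≠ 0)
  have hN1 : (N : ℂ) + 1 ≠ 0 := by
    exact_mod_cast Nat.succ_ne_zero N
  obtain ⟨hint, hval⟩ := HaarSecondMoment.integrable_and_integral_quadraticForm_sq μ hψ₀ hX
  have hmoment : ((X.trace ^ 2 + (X * X).trace) /
      (Fintype.card (Fin N) * (Fintype.card (Fin N) + 1)) : ℂ) = 1 / ((N : ℂ) + 1) := by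
    rw [htr, hX2, trace_one, Fintype.card_fin]
    field_simp
    ring
  rw [hmoment] at hval
  refine ⟨hval, ?_⟩
  have hfirst (U : Matrix.unitaryGroup (Fin N) ℂ) :
      star ψ₀ ⬝ᵥ (((U : Matrix (Fin N) (Fin N) ℂ)ᴴ * (X * X) *
        (U : Matrix (Fin N) (Fin N) ℂ)).mulVec ψ₀) = 1 := by
    rw [hX2, Matrix.mul_one, ← star_eq_conjTranspose, Unitary.coe_star_mul_self, one_mulVec, hψ₀]
  simp only [hfirst]
  rw [integral_sub (integrable_const _) hint, hval]
  simp
  field_simp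
  ring
end

section
/- Let N ≥ 2, let μ be the Haar probability measure on the unitary group U(N), let ψ₀ ∈ ℂ^N be a unit vector, and let A, B be N×N Hermitian matrices. Then ∫_{U(N)} ⟨ψ₀, U*AU ψ₀⟩ · ⟨ψ₀, U*BU ψ₀⟩ dμ(U) = (Tr A · Tr B + Tr(AB)) / (N(N+1)). -/
open MeasureTheory Matrix

namespace HaarSecondMoment

variable {N : ℕ}

/-- The quartic monomial `conj φᵢ · φⱼ · conj φₖ · φₗ` in the coordinates of `φ`. -/
def quarticMonomial (φ : Fin N → ℂ) (i j k l : Fin N) : ℂ :=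
  star (φ i) * φ j * (star (φ k) * φ l)

lemma form_mul_form_eq_sum (φ : Fin N → ℂ) (A B : Matrix (Fin N) (Fin N) ℂ) :
    (star φ ⬝ᵥ A *ᵥ φ) * (star φ ⬝ᵥ B *ᵥ φ) =
      ∑ i, ∑ j, ∑ k, ∑ l, A i j * B k l * quarticMonomial φ i j k l := by
  have h (C : Matrix (Fin N) (Fin N) ℂ) :
      star φ ⬝ᵥ C *ᵥ φ = ∑ i, ∑ j, C i j * (star (φ i) * φ j) := by
    simp only [dotProduct, mulVec, Pi.star_apply, Finset.mul_sum]
    exact Finset.sum_congr rfl fun i _ => Finset.sum_congr rfl fun j _ => by ring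
  rw [h A, h B]
  simp only [Finset.sum_mul]
  simp only [Finset.mul_sum, quarticMonomial]
  refine Finset.sum_congr rfl fun i _ => Finset.sum_congr rfl fun j _ =>
    Finset.sum_congr rfl fun k _ => Finset.sum_congr rfl fun l _ => by ring

lemma dotProduct_conj_mulVec (U A : Matrix (Fin N) (Fin N) ℂ) (ψ : Fin N → ℂ) :
    star ψ ⬝ᵥ ((Uᴴ * A * U) *ᵥ ψ) = star (U *ᵥ ψ) ⬝ᵥ (A *ᵥ (U *ᵥ ψ)) := by
  rw [star_mulVec, ← dotProduct_mulVec, mulVec_mulVec, mulVec_mulVec, Matrix.mul_assoc]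

/-- The diagonal matrix multiplying the `m`-th coordinate by the imaginary unit is unitary. -/
lemma diagonal_phase_mem (m : Fin N) :
    diagonal (fun n => if n = m then Complex.I else 1) ∈ unitaryGroup (Fin N) ℂ := by
  rw [mem_unitaryGroup_iff, star_eq_conjTranspose, diagonal_conjTranspose, diagonal_mul_diagonal,
    ← diagonal_one]
  congr 1
  ext n
  by_cases h : n = m <;> simp [h]

/-- Householder reflections are unitary. -/
lemma householder_mem (u : Fin N → ℂ) (h : star u ⬝ᵥ u = 2) :
    1 - vecMulVec u (star u) ∈ unitaryGroup (Fin N) ℂ := by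
  rw [mem_unitaryGroup_iff, star_eq_conjTranspose]
  simp only [conjTranspose_sub, conjTranspose_one, conjTranspose_vecMulVec,
    star_star, sub_mul, mul_sub, one_mul, mul_one, vecMulVec_mul_vecMulVec, vecMulVec_smul, h]
  module

lemma continuous_quarticMonomial (ψ : Fin N → ℂ) (i j k l : Fin N) :
    Continuous fun U : unitaryGroup (Fin N) ℂ =>
      quarticMonomial ((U : Matrix (Fin N) (Fin N) ℂ) *ᵥ ψ) i j k l := by
  have h (i : Fin N) : Continuous fun U : unitaryGroup (Fin N) ℂ =>
      ((U : Matrix (Fin N) (Fin N) ℂ) *ᵥ ψ) i :=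
    (continuous_apply i).comp (continuous_subtype_val.matrix_mulVec continuous_const)
  exact ((h i).star.mul (h j)).mul ((h k).star.mul (h l))

section Moments

variable [MeasurableSpace (unitaryGroup (Fin N) ℂ)]
  (μ : Measure (unitaryGroup (Fin N) ℂ)) (ψ : Fin N → ℂ)

/-- The moment `∫ conj φᵢ · φⱼ · conj φₖ · φₗ dμ(U)` of the random vector `φ = U ψ`. -/
noncomputable def moment (i j k l : Fin N) : ℂ :=
  ∫ U : unitaryGroup (Fin N) ℂ,
    quarticMonomial ((U : Matrix (Fin N) (Fin N) ℂ) *ᵥ ψ) i j k l ∂μ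

lemma integrable_quarticMonomial [BorelSpace (unitaryGroup (Fin N) ℂ)]
    [IsFiniteMeasure μ] (i j k l : Fin N) :
    Integrable (fun U : unitaryGroup (Fin N) ℂ =>
      quarticMonomial ((U : Matrix (Fin N) (Fin N) ℂ) *ᵥ ψ) i j k l) μ := by
  have h (U : unitaryGroup (Fin N) ℂ) (i : Fin N) :
      ‖((U : Matrix (Fin N) (Fin N) ℂ) *ᵥ ψ) i‖ ≤ ∑ j, ‖ψ j‖ := by
    simp only [mulVec, dotProduct]
    refine norm_sum_le_of_le _ fun j _ => ?_
    rw [norm_mul]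
    exact mul_le_of_le_one_left (norm_nonneg _) (entry_norm_bound_of_unitary U.2 _ _)
  refine Integrable.of_bound (continuous_quarticMonomial ψ i j k l).aestronglyMeasurable
    ((∑ j, ‖ψ j‖) * (∑ j, ‖ψ j‖) * ((∑ j, ‖ψ j‖) * (∑ j, ‖ψ j‖))) (.of_forall fun U => ?_)
  simp only [quarticMonomial, norm_mul, norm_star]
  gcongr <;> exact h U _

lemma integral_sum_quarticMonomial [BorelSpace (unitaryGroup (Fin N) ℂ)]
    [IsFiniteMeasure μ] (c : Fin N → Fin N → Fin N → Fin N → ℂ) :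
    ∫ U : unitaryGroup (Fin N) ℂ, ∑ i, ∑ j, ∑ k, ∑ l,
        c i j k l * quarticMonomial ((U : Matrix (Fin N) (Fin N) ℂ) *ᵥ ψ) i j k l ∂μ =
      ∑ i, ∑ j, ∑ k, ∑ l, c i j k l * moment μ ψ i j k l := by
  have h i j k l := (integrable_quarticMonomial μ ψ i j k l).const_mul (c i j k l)
  simp only [moment, ← integral_const_mul]
  rw [integral_finsetSum _ fun i _ => integrable_finsetSum _ fun j _ =>
    integrable_finsetSum _ fun k _ => integrable_finsetSum _ fun l _ => h i j k l]
  refine Finset.sum_congr rfl fun i _ => ?_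
  rw [integral_finsetSum _ fun j _ =>
    integrable_finsetSum _ fun k _ => integrable_finsetSum _ fun l _ => h i j k l]
  refine Finset.sum_congr rfl fun j _ => ?_
  rw [integral_finsetSum _ fun k _ => integrable_finsetSum _ fun l _ => h i j k l]
  refine Finset.sum_congr rfl fun k _ => ?_
  rw [integral_finsetSum _ fun l _ => h i j k l]

lemma integral_form_mul_form [BorelSpace (unitaryGroup (Fin N) ℂ)]
    [IsFiniteMeasure μ] (A B : Matrix (Fin N) (Fin N) ℂ) :
    ∫ U : unitaryGroup (Fin N) ℂ,
        (star ψ ⬝ᵥ (((U : Matrix (Fin N) (Fin N) ℂ)ᴴ * A *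
            (U : Matrix (Fin N) (Fin N) ℂ)) *ᵥ ψ)) *
          (star ψ ⬝ᵥ (((U : Matrix (Fin N) (Fin N) ℂ)ᴴ * B *
            (U : Matrix (Fin N) (Fin N) ℂ)) *ᵥ ψ)) ∂μ =
      ∑ i, ∑ j, ∑ k, ∑ l, A i j * B k l * moment μ ψ i j k l := by
  simp only [dotProduct_conj_mulVec, form_mul_form_eq_sum]
  exact integral_sum_quarticMonomial μ ψ _

lemma moment_swap (i j k l : Fin N) : moment μ ψ i j k l = moment μ ψ i l k j := by
  simp only [moment, quarticMonomial]
  congr 1 with U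
  ring

lemma moment_swap_pairs (i j k l : Fin N) : moment μ ψ i j k l = moment μ ψ k l i j := by
  simp only [moment, quarticMonomial]
  congr 1 with U
  ring

/-- Left invariance of the moments under a fixed unitary. -/
lemma integral_quarticMonomial_mulVec [BorelSpace (unitaryGroup (Fin N) ℂ)]
    [μ.IsMulLeftInvariant] {V : Matrix (Fin N) (Fin N) ℂ}
    (hV : V ∈ unitaryGroup (Fin N) ℂ) (i j k l : Fin N) :
    ∫ U : unitaryGroup (Fin N) ℂ,
      quarticMonomial (V *ᵥ ((U : Matrix (Fin N) (Fin N) ℂ) *ᵥ ψ)) i j k l ∂μ =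
        moment μ ψ i j k l := by
  simp only [mulVec_mulVec]
  exact integral_mul_left_eq_self (fun U : unitaryGroup (Fin N) ℂ =>
    quarticMonomial ((U : Matrix (Fin N) (Fin N) ℂ) *ᵥ ψ) i j k l)
    (⟨V, hV⟩ : unitaryGroup (Fin N) ℂ)

/-- Invariance under diagonal phases kills the unbalanced moments. -/
lemma moment_eq_zero [BorelSpace (unitaryGroup (Fin N) ℂ)]
    [μ.IsMulLeftInvariant] {i j k l : Fin N}
    (h : ¬((i = j ∧ k = l) ∨ (i = l ∧ k = j))) : moment μ ψ i j k l = 0 := by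
  have key (m : Fin N) : moment μ ψ i j k l =
      (star (if i = m then Complex.I else 1) * (if j = m then Complex.I else 1) *
        (star (if k = m then Complex.I else 1) * (if l = m then Complex.I else 1))) *
        moment μ ψ i j k l := by
    conv_lhs => rw [← integral_quarticMonomial_mulVec μ ψ (diagonal_phase_mem m)]
    rw [moment, ← integral_const_mul]
    congr 1 with U
    simp only [quarticMonomial, mulVec_diagonal, star_mul']
    ring
  by_contra h_ne
  have hm (m : Fin N) := mul_right_cancel₀ h_ne ((one_mul _).trans (key m))
  by_cases hij : i = j
  · have hkl : k ≠ l := fun hkl => h (.inl ⟨hij, hkl⟩)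
    have := hm k
    subst hij
    by_cases hik : i = k <;> simp [hik, hkl.symm, Complex.ext_iff] at this
  · by_cases hil : i = l
    · have hkj : k ≠ j := fun hkj => h (.inr ⟨hil, hkj⟩)
      have := hm k
      subst hil
      by_cases hik : i = k <;> simp [hik, hkj.symm, Complex.ext_iff] at this
    · have := hm i
      by_cases hik : k = i <;> norm_num [hik, Ne.symm hij, Ne.symm hil, Complex.ext_iff] at this

/-- The moment `∫ |φᵢ|² |φₖ|² dμ(U)` of `φ = U ψ`, halved on the diagonal. -/
noncomputable def symmMoment (i k : Fin N) : ℂ :=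
  if i = k then moment μ ψ i i i i / 2 else moment μ ψ i i k k

lemma moment_eq [BorelSpace (unitaryGroup (Fin N) ℂ)]
    [μ.IsMulLeftInvariant] (i j k l : Fin N) :
    moment μ ψ i j k l =
      ((if i = j ∧ k = l then 1 else 0) + (if i = l ∧ k = j then 1 else 0)) *
        symmMoment μ ψ i k := by
  unfold symmMoment
  by_cases h : (i = j ∧ k = l) ∨ (i = l ∧ k = j)
  · by_cases hik : i = k
    · subst hik
      have : i = j ∧ i = l := by tauto
      obtain ⟨rfl, rfl⟩ := this
      simp
      ring
    · rcases h with ⟨rfl, rfl⟩ | ⟨rfl, rfl⟩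
      · simp [hik]
      · rw [moment_swap]
        simp [hik]
  · rw [moment_eq_zero μ ψ h]
    obtain ⟨h₁, h₂⟩ := not_or.mp h
    simp [h₁, h₂]

lemma sum_mul_moment [BorelSpace (unitaryGroup (Fin N) ℂ)]
    [μ.IsMulLeftInvariant] (c : Fin N → Fin N → Fin N → Fin N → ℂ) :
    ∑ i, ∑ j, ∑ k, ∑ l, c i j k l * moment μ ψ i j k l =
      ∑ i, ∑ k, (c i i k k + c i k k i) * symmMoment μ ψ i k := by
  refine Finset.sum_congr rfl fun i _ => ?_
  rw [Finset.sum_comm]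
  refine Finset.sum_congr rfl fun k _ => ?_
  simp only [moment_eq, ite_and, add_mul, mul_add, Finset.sum_add_distrib, ite_mul, one_mul,
    zero_mul, mul_ite, mul_zero, Finset.sum_ite_eq, Finset.sum_ite_irrel, Finset.sum_const_zero,
    Finset.mem_univ, if_true]

lemma symmMoment_self_eq_sum [BorelSpace (unitaryGroup (Fin N) ℂ)]
    [μ.IsMulLeftInvariant] [IsFiniteMeasure μ]
    {V : Matrix (Fin N) (Fin N) ℂ} (hV : V ∈ unitaryGroup (Fin N) ℂ) (p : Fin N) :
    symmMoment μ ψ p p =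
      ∑ i, ∑ k, (star (V p i) * V p i) * (star (V p k) * V p k) * symmMoment μ ψ i k := by
  have h : moment μ ψ p p p p = ∑ i, ∑ k, ((star (V p i) * V p i) * (star (V p k) * V p k) +
      (star (V p i) * V p k) * (star (V p k) * V p i)) * symmMoment μ ψ i k := by
    rw [← sum_mul_moment μ ψ fun i j k l => (star (V p i) * V p j) * (star (V p k) * V p l),
      ← integral_sum_quarticMonomial, ← integral_quarticMonomial_mulVec μ ψ hV]
    congr 1 with U
    set φ := (U : Matrix (Fin N) (Fin N) ℂ) *ᵥ ψ
    have := form_mul_form_eq_sum φ (vecMulVec (star (V p)) (V p)) (vecMulVec (star (V p)) (V p))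
    simp only [vecMulVec_apply, Pi.star_apply] at this
    rw [← this, vecMulVec_mulVec, quarticMonomial]
    have h' : star ((V *ᵥ φ) p) = star φ ⬝ᵥ star (V p) := (star_dotProduct_star φ (V p)).symm
    have h'' : (V *ᵥ φ) p = V p ⬝ᵥ φ := rfl
    rw [h', h'']
    simp [mul_comm]
  rw [symmMoment, if_pos rfl, h, Finset.sum_div]
  refine Finset.sum_congr rfl fun i _ => ?_
  rw [Finset.sum_div]
  refine Finset.sum_congr rfl fun k _ => ?_
  ring

lemma symmMoment_comm (p q : Fin N) : symmMoment μ ψ p q = symmMoment μ ψ q p := by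
  by_cases h : p = q
  · rw [h]
  · rw [symmMoment, symmMoment, if_neg h, if_neg (Ne.symm h), moment_swap_pairs]

/-- Invariance under the reflection along `s • eₚ + t • e_q` relates the moments. -/
lemma symmMoment_self_relation [BorelSpace (unitaryGroup (Fin N) ℂ)]
    [μ.IsMulLeftInvariant] [IsFiniteMeasure μ] {p q : Fin N} (h : p ≠ q) (s t : ℝ)
    (hst : s ^ 2 + t ^ 2 = 2) :
    symmMoment μ ψ p p = (1 - s ^ 2) ^ 4 * symmMoment μ ψ p p +
      2 * (1 - s ^ 2) ^ 2 * (s * t) ^ 2 * symmMoment μ ψ p q +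
        (s * t) ^ 4 * symmMoment μ ψ q q := by
  set u : Fin N → ℂ := (s : ℂ) • Pi.single p 1 + (t : ℂ) • Pi.single q 1 with hu
  have hup : u p = s := by simp [hu, h]
  have huq : u q = t := by simp [hu, h.symm]
  have hstar : star u = u := by
    ext i
    by_cases hp : i = p
    · simp [hp, hup]
    · by_cases hq : i = q
      · simp [hq, huq]
      · simp [hu, hp, hq]
  have hV : 1 - vecMulVec u (star u) ∈ unitaryGroup (Fin N) ℂ := by
    refine householder_mem u ?_
    rw [hstar]
    nth_rw 1 [hu]
    simp only [add_dotProduct, smul_dotProduct, single_one_dotProduct, hup, huq, smul_eq_mul]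
    exact_mod_cast (by linarith : s * s + t * t = 2)
  have hrow (i : Fin N) :
      star ((1 - vecMulVec u (star u)) p i) * (1 - vecMulVec u (star u)) p i =
        (if p = i then (1 - (s : ℂ) ^ 2) ^ 2 else 0) +
          (if q = i then ((s : ℂ) * t) ^ 2 else 0) := by
    rw [hstar, Matrix.sub_apply, vecMulVec_apply, hup]
    by_cases hip : p = i
    · subst hip
      simp [hup, h.symm]
      ring
    · by_cases hiq : q = i
      · subst hiq
        simp [huq, h]
        ring
      · simp [hu, hip, hiq, Ne.symm hip, Ne.symm hiq]
  refine (symmMoment_self_eq_sum μ ψ hV p).trans ?_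
  simp only [hrow, add_mul, mul_add, Finset.sum_add_distrib, ite_mul, zero_mul, mul_ite, mul_zero,
    Finset.sum_ite_eq, Finset.mem_univ, if_true]
  rw [symmMoment_comm μ ψ q p]
  ring

lemma symmMoment_eq_of_ne [BorelSpace (unitaryGroup (Fin N) ℂ)]
    [μ.IsMulLeftInvariant] [IsFiniteMeasure μ] {p q : Fin N} (h : p ≠ q) :
    symmMoment μ ψ p p = symmMoment μ ψ q q ∧ symmMoment μ ψ p q = symmMoment μ ψ q q := by
  have hs : (√(2 / 5) : ℝ) ^ 2 = 2 / 5 := Real.sq_sqrt (by norm_num)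
  have hs' : ((√(2 / 5) : ℝ) : ℂ) ^ 2 = 2 / 5 := by rw [← Complex.ofReal_pow, hs]; norm_num
  have hst : (√(2 / 5) : ℝ) ^ 2 + (2 * √(2 / 5)) ^ 2 = 2 := by rw [mul_pow, hs]; norm_num
  have h₁ := symmMoment_self_relation μ ψ h _ _ hst
  have h₂ := symmMoment_self_relation μ ψ h.symm _ _ hst
  rw [symmMoment_comm μ ψ q p] at h₂
  have hx : ((√(2 / 5) : ℝ) : ℂ) * ((2 * √(2 / 5) : ℝ) : ℂ) = 4 / 5 := by
    push_cast
    linear_combination 2 * hs'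
  rw [hs', hx] at h₁ h₂
  have hpq : symmMoment μ ψ p p = symmMoment μ ψ q q := by
    linear_combination (25 / 32) * (h₁ - h₂)
  refine ⟨hpq, ?_⟩
  linear_combination (-(625 / 288)) * h₁ + (544 / 288) * hpq

lemma exists_integral_form_mul_form_eq [BorelSpace (unitaryGroup (Fin N) ℂ)]
    [μ.IsMulLeftInvariant] [IsFiniteMeasure μ] :
    ∃ c : ℂ, ∀ A B : Matrix (Fin N) (Fin N) ℂ,
      ∫ U : unitaryGroup (Fin N) ℂ,
        (star ψ ⬝ᵥ (((U : Matrix (Fin N) (Fin N) ℂ)ᴴ * A *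
            (U : Matrix (Fin N) (Fin N) ℂ)) *ᵥ ψ)) *
          (star ψ ⬝ᵥ (((U : Matrix (Fin N) (Fin N) ℂ)ᴴ * B *
            (U : Matrix (Fin N) (Fin N) ℂ)) *ᵥ ψ)) ∂μ =
        (A.trace * B.trace + (A * B).trace) * c := by
  obtain ⟨c, hc⟩ : ∃ c, ∀ i k, symmMoment μ ψ i k = c := by
    rcases isEmpty_or_nonempty (Fin N) with _ | ⟨⟨r⟩⟩
    · exact ⟨0, fun i => isEmptyElim i⟩
    · have hdiag (k : Fin N) : symmMoment μ ψ k k = symmMoment μ ψ r r := by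
        by_cases hk : k = r
        · rw [hk]
        · exact (symmMoment_eq_of_ne μ ψ hk).1
      refine ⟨symmMoment μ ψ r r, fun i k => ?_⟩
      by_cases hik : i = k
      · rw [hik, hdiag]
      · rw [(symmMoment_eq_of_ne μ ψ hik).2, hdiag]
  refine ⟨c, fun A B => ?_⟩
  rw [integral_form_mul_form, sum_mul_moment μ ψ fun i j k l => A i j * B k l]
  simp only [hc, ← Finset.sum_mul, Finset.sum_add_distrib, trace, diag_apply, mul_apply,
    Finset.sum_mul_sum]

end Moments

end HaarSecondMoment

open HaarSecondMoment in
/-- **Second-moment (unitary 2-design) formula for Haar averages.**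
For Haar probability measure `μ` on `U(N)` with `N ≥ 2`, a unit vector `ψ₀ ∈ ℂ^N` and
Hermitian matrices `A`, `B`, one has
`∫ ⟨ψ₀, U*AU ψ₀⟩ ⟨ψ₀, U*BU ψ₀⟩ dμ = (Tr A · Tr B + Tr(AB)) / (N(N+1))`. -/
theorem haar_second_moment_formula
    {N : ℕ} (hN : 2 ≤ N)
    [MeasurableSpace (Matrix.unitaryGroup (Fin N) ℂ)]
    [BorelSpace (Matrix.unitaryGroup (Fin N) ℂ)]
    (μ : Measure (Matrix.unitaryGroup (Fin N) ℂ))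
    [μ.IsHaarMeasure] [IsProbabilityMeasure μ]
    (ψ₀ : Fin N → ℂ) (hψ₀ : star ψ₀ ⬝ᵥ ψ₀ = 1)
    (A B : Matrix (Fin N) (Fin N) ℂ) (hA : A.IsHermitian) (hB : B.IsHermitian) :
    (∫ U : Matrix.unitaryGroup (Fin N) ℂ,
        (star ψ₀ ⬝ᵥ (((U : Matrix (Fin N) (Fin N) ℂ)ᴴ * A *
            (U : Matrix (Fin N) (Fin N) ℂ)).mulVec ψ₀))
          * (star ψ₀ ⬝ᵥ (((U : Matrix (Fin N) (Fin N) ℂ)ᴴ * B *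
            (U : Matrix (Fin N) (Fin N) ℂ)).mulVec ψ₀)) ∂μ)
      = (A.trace * B.trace + (A * B).trace) / ((N : ℂ) * ((N : ℂ) + 1)) := by
  obtain ⟨c, hc⟩ := exists_integral_form_mul_form_eq μ ψ₀
  have h_one := hc 1 1
  have h_unit (U : unitaryGroup (Fin N) ℂ) :
      (U : Matrix (Fin N) (Fin N) ℂ)ᴴ * (U : Matrix (Fin N) (Fin N) ℂ) = 1 :=
    UnitaryGroup.star_mul_self U
  simp only [mul_one, h_unit, one_mulVec, hψ₀, integral_const, probReal_univ, one_smul,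
    trace_one, Fintype.card_fin] at h_one
  have h_ne : (N : ℂ) * ((N : ℂ) + 1) ≠ 0 := by
    refine mul_ne_zero ?_ (Nat.cast_add_one_ne_zero N)
    exact_mod_cast (by omega : N ≠ 0)
  rw [hc, eq_div_iff h_ne]
  linear_combination (-(A.trace * B.trace + (A * B).trace)) * h_one
end

section
/- Let N ≥ 2, let A, B, C be independent Haar-distributed random elements of U(N), let ψ₀ ∈ ℂ^N be a unit vector, and let X₁, X₂ be N×N Hermitian matrices with Tr X₁ = Tr X₂ = 0. Define the circuit state ψ = ABC ψ₀ and tangent vectors v₁ = AB X₁ C ψ₀ and v₂ = A X₂ BC ψ₀ (corresponding to derivatives of a parameterized circuit with respect to two parameters at different layers). Then the expectation of the off-diagonal Fubini–Study metric element vanishes: E[ Re(⟨v₁, v₂⟩ − ⟨v₁, ψ⟩⟨ψ, v₂⟩) ] = 0. -/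
open MeasureTheory Matrix

/-- The unitary group is compact: it is closed and its entries are bounded by `1`. -/
theorem compactSpace_unitaryGroup {n : Type*} [Fintype n] [DecidableEq n] :
    CompactSpace (Matrix.unitaryGroup n ℂ) := by
  refine isCompact_iff_compactSpace.mp ?_
  have hK : IsCompact (Set.univ.pi fun _ : n => Set.univ.pi fun _ : n =>
      Metric.closedBall (0 : ℂ) 1) :=
    isCompact_univ_pi fun _ => isCompact_univ_pi fun _ => isCompact_closedBall 0 1
  refine hK.of_isClosed_subset (isClosed_unitary (R := Matrix n n ℂ)) ?_
  intro U hU i _ j _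
  simpa using entry_norm_bound_of_unitary hU i j

theorem permMatrix_mem_unitaryGroup {n : Type*} [Fintype n] [DecidableEq n] (σ : Equiv.Perm n) :
    σ.permMatrix ℂ ∈ Matrix.unitaryGroup n ℂ := by
  rw [mem_unitaryGroup_iff, star_eq_conjTranspose, conjTranspose_permMatrix, ← permMatrix_mul]
  simp

/-- An additive functional on matrices that is invariant under unitary conjugation vanishes on
traceless matrices. -/
theorem map_eq_zero_of_unitary_conj_invariant {n : Type*} [Fintype n] [DecidableEq n]
    (F : Matrix n n ℂ →+ ℝ)
    (hF : ∀ U ∈ Matrix.unitaryGroup n ℂ, ∀ X, F (star U * X * U) = F X)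
    {X : Matrix n n ℂ} (hX : X.trace = 0) : F X = 0 := by
  have hoff : ∀ i j : n, i ≠ j → ∀ c : ℂ, F (single i j c) = 0 := by
    intro i j hij c
    let D : Matrix n n ℂ := diagonal fun k => if k = i then -1 else 1
    have hD : star D = D := by
      rw [star_eq_conjTranspose, diagonal_conjTranspose]
      congr 1
      ext k
      by_cases hk : k = i <;> simp [hk]
    have hDU : D ∈ Matrix.unitaryGroup n ℂ := by
      rw [mem_unitaryGroup_iff, hD, diagonal_mul_diagonal, ← diagonal_one]
      congr 1
      ext k
      by_cases hk : k = i <;> simp [hk]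
    have hconj : star D * single i j c * D = -single i j c := by
      rw [hD]
      ext k l
      simp only [D, mul_diagonal, diagonal_mul, single_apply]
      by_cases h : i = k ∧ j = l
      · obtain ⟨rfl, rfl⟩ := h
        simp [hij.symm]
      · simp [h]
    have h := hF D hDU (single i j c)
    rw [hconj, map_neg] at h
    linarith
  have hdiag : ∀ i j : n, ∀ c : ℂ, F (single i i c) = F (single j j c) := by
    intro i j c
    rw [← hF _ (permMatrix_mem_unitaryGroup (Equiv.swap i j)) (single i i c)]
    congr 1
    rw [star_eq_conjTranspose, conjTranspose_permMatrix, Equiv.swap_inv]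
    ext k l
    simp only [PEquiv.toMatrix_toPEquiv_mul, PEquiv.mul_toMatrix_toPEquiv, submatrix_apply, id,
      single_apply, Equiv.symm_swap, Equiv.Perm.permMatrix]
    simp only [eq_comm (a := i), eq_comm (a := j), Equiv.swap_apply_eq_iff, Equiv.swap_apply_left]
  rcases isEmpty_or_nonempty n with _ | ⟨⟨k⟩⟩
  · rw [Subsingleton.elim X 0, map_zero]
  calc F X = ∑ i, ∑ j, F (single i j (X i j)) := by
        conv_lhs => rw [matrix_eq_sum_single X]
        simp only [map_sum]
    _ = ∑ i, F (single k k (X i i)) := by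
        refine Finset.sum_congr rfl fun i _ => ?_
        rw [Finset.sum_eq_single i (fun j _ hj => hoff i j hj.symm _) (by simp), hdiag i k]
    _ = F (single k k X.trace) := by
        rw [← map_sum]
        exact congrArg F (map_sum (singleAddMonoidHom k k) X.diag Finset.univ).symm
    _ = 0 := by rw [hX, single_zero, map_zero]

/-- The Haar average over `B` of a functional of `B† X B` vanishes for traceless `X`, even if the
functional depends on a further unitary over which one averages first. -/
theorem integral_integral_conj_eq_zero {n : Type*} [Fintype n] [DecidableEq n]
    [MeasurableSpace (Matrix.unitaryGroup n ℂ)] [BorelSpace (Matrix.unitaryGroup n ℂ)]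
    (μ : Measure (Matrix.unitaryGroup n ℂ)) [μ.IsMulLeftInvariant] [IsFiniteMeasure μ]
    (q : Matrix.unitaryGroup n ℂ → Matrix n n ℂ →+ ℝ)
    (hq : Continuous fun p : Matrix.unitaryGroup n ℂ × Matrix n n ℂ => q p.1 p.2)
    {X : Matrix n n ℂ} (hX : X.trace = 0) :
    ∫ B : Matrix.unitaryGroup n ℂ, ∫ C, q C (star (B : Matrix n n ℂ) * X * B) ∂μ ∂μ = 0 := by
  have := compactSpace_unitaryGroup (n := n)
  have : SecondCountableTopology (Matrix n n ℂ) :=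
    inferInstanceAs (SecondCountableTopology (n → n → ℂ))
  have : SecondCountableTopology (Matrix.unitaryGroup n ℂ) :=
    TopologicalSpace.Subtype.secondCountableTopology _
  have hint : ∀ f : Matrix.unitaryGroup n ℂ → ℝ, Continuous f → Integrable f μ := fun f hf =>
    hf.integrable_of_hasCompactSupport (HasCompactSupport.of_compactSpace f)
  have hcont : ∀ Y : Matrix n n ℂ, Continuous (Function.uncurry
      fun B C : Matrix.unitaryGroup n ℂ => q C (star (B : Matrix n n ℂ) * Y * B)) := fun Y =>
    hq.comp (f := fun p : Matrix.unitaryGroup n ℂ × Matrix.unitaryGroup n ℂ =>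
      (p.2, star (p.1 : Matrix n n ℂ) * Y * p.1)) (by fun_prop)
  have hinner : ∀ (Y : Matrix n n ℂ) (B : Matrix.unitaryGroup n ℂ),
      Integrable (fun C => q C (star (B : Matrix n n ℂ) * Y * B)) μ := fun Y B =>
    hint _ ((hcont Y).comp (Continuous.prodMk_right B))
  have houter : ∀ Y : Matrix n n ℂ, Integrable
      (fun B : Matrix.unitaryGroup n ℂ => ∫ C, q C (star (B : Matrix n n ℂ) * Y * B) ∂μ) μ := by
    intro Y
    refine hint _ ?_
    simpa using continuous_parametric_integral_of_continuous (μ := μ) (hcont Y) isCompact_univ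
  let F : Matrix n n ℂ →+ ℝ := AddMonoidHom.mk'
    (fun Y => ∫ B : Matrix.unitaryGroup n ℂ, ∫ C, q C (star (B : Matrix n n ℂ) * Y * B) ∂μ ∂μ)
    (by
      intro Y Z
      rw [← integral_add (houter Y) (houter Z)]
      refine integral_congr_ae (.of_forall fun B => ?_)
      simp only
      rw [← integral_add (hinner Y B) (hinner Z B)]
      simp only [mul_add, add_mul, map_add])
  refine map_eq_zero_of_unitary_conj_invariant F (fun U hU Y => ?_) hX
  have h := integral_mul_left_eq_self (μ := μ)
    (fun B : Matrix.unitaryGroup n ℂ => ∫ C, q C (star (B : Matrix n n ℂ) * Y * B) ∂μ) ⟨U, hU⟩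
  simp only [Submonoid.coe_mul, star_mul] at h
  simpa only [F, AddMonoidHom.mk'_apply, mul_assoc] using h

/-- **Haar average of off-diagonal Fubini–Study metric elements vanishes.**
Let `A, B, C` be independent Haar-distributed unitaries (expectation realized as the iterated
integral against the Haar probability measure `μ`), `ψ₀` a unit vector and `X₁, X₂` traceless
Hermitian matrices.  With circuit state `ψ = A B C ψ₀` and tangent vectors
`v₁ = A B X₁ C ψ₀`, `v₂ = A X₂ B C ψ₀`, one has
`E[Re(⟨v₁, v₂⟩ - ⟨v₁, ψ⟩⟨ψ, v₂⟩)] = 0`. -/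
theorem haar_average_offdiagonal_fubini_study_vanishes
    {N : ℕ} (hN : 2 ≤ N)
    [MeasurableSpace (Matrix.unitaryGroup (Fin N) ℂ)]
    [BorelSpace (Matrix.unitaryGroup (Fin N) ℂ)]
    (μ : Measure (Matrix.unitaryGroup (Fin N) ℂ))
    [μ.IsHaarMeasure] [IsProbabilityMeasure μ]
    (ψ₀ : Fin N → ℂ) (hψ₀ : star ψ₀ ⬝ᵥ ψ₀ = 1)
    (X₁ X₂ : Matrix (Fin N) (Fin N) ℂ)
    (hX₁ : X₁.IsHermitian) (hX₂ : X₂.IsHermitian)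
    (htr₁ : X₁.trace = 0) (htr₂ : X₂.trace = 0) :
    (∫ A : Matrix.unitaryGroup (Fin N) ℂ,
      ∫ B : Matrix.unitaryGroup (Fin N) ℂ,
        ∫ C : Matrix.unitaryGroup (Fin N) ℂ,
          (let ψ := ((A : Matrix (Fin N) (Fin N) ℂ) * (B : Matrix (Fin N) (Fin N) ℂ) *
              (C : Matrix (Fin N) (Fin N) ℂ)).mulVec ψ₀
           let v₁ := ((A : Matrix (Fin N) (Fin N) ℂ) * (B : Matrix (Fin N) (Fin N) ℂ) * X₁ *
              (C : Matrix (Fin N) (Fin N) ℂ)).mulVec ψ₀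
           let v₂ := ((A : Matrix (Fin N) (Fin N) ℂ) * X₂ * (B : Matrix (Fin N) (Fin N) ℂ) *
              (C : Matrix (Fin N) (Fin N) ℂ)).mulVec ψ₀
           ((star v₁ ⬝ᵥ v₂) - (star v₁ ⬝ᵥ ψ) * (star ψ ⬝ᵥ v₂)).re) ∂μ ∂μ ∂μ) = 0 := by
  let q : Matrix.unitaryGroup (Fin N) ℂ → Matrix (Fin N) (Fin N) ℂ →+ ℝ := fun C =>
    let φ := (C : Matrix (Fin N) (Fin N) ℂ) *ᵥ ψ₀
    AddMonoidHom.mk' (fun Y => ((star (X₁ *ᵥ φ) ⬝ᵥ (Y *ᵥ φ)) -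
      (star (X₁ *ᵥ φ) ⬝ᵥ φ) * (star φ ⬝ᵥ (Y *ᵥ φ))).re) (by
        intro Y Z
        rw [← Complex.add_re]
        congr 1
        rw [add_mulVec, dotProduct_add, dotProduct_add]
        ring)
  have hq : Continuous fun p : Matrix.unitaryGroup (Fin N) ℂ × Matrix (Fin N) (Fin N) ℂ =>
      q p.1 p.2 := by
    simp only [q, AddMonoidHom.mk'_apply]
    fun_prop
  have hcancel : ∀ U ∈ Matrix.unitaryGroup (Fin N) ℂ, ∀ x y : Fin N → ℂ,
      star (U *ᵥ x) ⬝ᵥ (U *ᵥ y) = star x ⬝ᵥ y := by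
    intro U hU x y
    rw [star_mulVec, dotProduct_mulVec, vecMul_vecMul, ← star_eq_conjTranspose,
      mem_unitaryGroup_iff'.mp hU, vecMul_one]
  refine integral_eq_zero_of_ae (.of_forall fun A => ?_)
  refine Eq.trans ?_ (integral_integral_conj_eq_zero μ q hq htr₂)
  refine integral_congr_ae (.of_forall fun B => integral_congr_ae (.of_forall fun C => ?_))
  have hv₂ : (A.1 * X₂ * B.1 * C.1) *ᵥ ψ₀ =
      (A * B).1 *ᵥ ((star B.1 * X₂ * B.1) *ᵥ (C.1 *ᵥ ψ₀)) := by
    have hB : B.1 * star B.1 = 1 := mem_unitaryGroup_iff.mp B.2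
    simp only [mulVec_mulVec, Submonoid.coe_mul]
    congr 1
    calc _ = A.1 * (B.1 * star B.1) * X₂ * B.1 * C.1 := by rw [hB, mul_one]
      _ = _ := by simp only [mul_assoc]
  have hv₁ : (A.1 * B.1 * X₁ * C.1) *ᵥ ψ₀ = (A * B).1 *ᵥ (X₁ *ᵥ (C.1 *ᵥ ψ₀)) := by
    simp only [mulVec_mulVec, Submonoid.coe_mul, mul_assoc]
  have hψ : (A.1 * B.1 * C.1) *ᵥ ψ₀ = (A * B).1 *ᵥ (C.1 *ᵥ ψ₀) := by
    simp only [mulVec_mulVec, Submonoid.coe_mul]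
  simp only [q, AddMonoidHom.mk'_apply]
  rw [hv₁, hv₂, hψ, hcancel _ (A * B).2, hcancel _ (A * B).2, hcancel _ (A * B).2]
end

section
/- Let N ≥ 2, let U₁, U₂, U₃, U₄ be independent Haar-distributed random elements of U(N), let ψ₀ ∈ ℂ^N be a unit vector, and let X be an N×N Hermitian matrix with Tr X = 0 and X² = I. Define T = ⟨ψ₀, U₁* X U₂* U₃ X U₄ ψ₀⟩ (a complex random variable) and P = ⟨ψ₀, U₁* X U₁ ψ₀⟩ · ⟨ψ₀, U₄* X U₄ ψ₀⟩ (a real random variable), and set g = Re(T) − P, the off-diagonal Fubini–Study metric element of the random circuit ansatz. Then E[g²] = 1/(2N) + 1/(N+1)². -/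
open MeasureTheory Matrix

namespace Matrix

section UnitaryGroup

variable {n : Type*} [Fintype n] [DecidableEq n]

instance compactSpace_unitaryGroup : CompactSpace (unitaryGroup n ℂ) := by
  refine isCompact_iff_compactSpace.mp (IsCompact.of_isClosed_subset
    (isCompact_univ_pi fun _ : n => isCompact_univ_pi fun _ : n =>
      isCompact_closedBall (0 : ℂ) 1)
    (isClosed_unitary (R := Matrix n n ℂ)) fun U hU => ?_)
  exact fun i _ j _ => mem_closedBall_zero_iff.mpr (entry_norm_bound_of_unitary hU i j)

/-- A complex reflection `v ↦ v + α ⟨u, v⟩ u` is unitary when `α` has the right modulus. -/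
theorem one_add_smul_vecMulVec_mem_unitaryGroup {u : n → ℂ} {α : ℂ}
    (h : α + star α + star α * α * (star u ⬝ᵥ u) = 0) :
    1 + α • vecMulVec u (star u) ∈ unitaryGroup n ℂ := by
  have hs : (vecMulVec u (star u))ᴴ = vecMulVec u (star u) := by
    rw [conjTranspose_vecMulVec, star_star]
  have hm : vecMulVec u (star u) * vecMulVec u (star u)
      = (star u ⬝ᵥ u) • vecMulVec u (star u) := by
    rw [vecMulVec_mul_vecMulVec, vecMulVec_smul]
  rw [mem_unitaryGroup_iff', star_eq_conjTranspose, conjTranspose_add, conjTranspose_one,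
    conjTranspose_smul, hs, add_mul, mul_add, mul_add, one_mul, one_mul, mul_one, smul_mul_smul_comm,
    hm, smul_smul, add_assoc, ← add_smul, ← add_smul, ← add_assoc, h, zero_smul, add_zero]

theorem smul_one_mem_unitaryGroup {z : ℂ} (hz : star z * z = 1) :
    z • (1 : Matrix n n ℂ) ∈ unitaryGroup n ℂ := by
  simp only [mem_unitaryGroup_iff', star_smul, star_one, smul_mul_smul_comm, hz, mul_one, one_smul]

theorem star_dotProduct_mulVec_unitary {A : Matrix n n ℂ} (hA : A ∈ unitaryGroup n ℂ)
    (v : n → ℂ) : star (A *ᵥ v) ⬝ᵥ (A *ᵥ v) = star v ⬝ᵥ v := by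
  rw [star_mulVec, ← dotProduct_mulVec, mulVec_mulVec, ← star_eq_conjTranspose,
    mem_unitaryGroup_iff'.mp hA, one_mulVec]

end UnitaryGroup

theorem star_dotProduct_self_eq_sum_normSq {n : Type*} [Fintype n] (v : n → ℂ) :
    star v ⬝ᵥ v = ((∑ i, Complex.normSq (v i) : ℝ) : ℂ) := by
  simp [dotProduct, Complex.normSq_eq_conj_mul_self]

theorem sum_normSq_mulVec {n : Type*} [Fintype n] [DecidableEq n] {ψ : n → ℂ}
    (hψ : star ψ ⬝ᵥ ψ = 1) (U : unitaryGroup n ℂ) : ∑ k, Complex.normSq ((U.1 *ᵥ ψ) k) = 1 := by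
  have := star_dotProduct_mulVec_unitary U.2 ψ
  rw [hψ, star_dotProduct_self_eq_sum_normSq] at this
  exact_mod_cast this

/-- Diagonalisation of the quadratic form of a Hermitian matrix. -/
theorem IsHermitian.star_dotProduct_mulVec_eq {n : Type*} [Fintype n] [DecidableEq n]
    {X : Matrix n n ℂ} (hX : X.IsHermitian) (v : n → ℂ) :
    star v ⬝ᵥ (X *ᵥ v) = ((∑ i, hX.eigenvalues i *
      Complex.normSq ((star (hX.eigenvectorUnitary : Matrix n n ℂ) *ᵥ v) i) : ℝ) : ℂ) := by
  conv_lhs => rw [hX.spectral_theorem]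
  rw [Unitary.conjStarAlgAut_apply, ← mulVec_mulVec, ← mulVec_mulVec, dotProduct_mulVec]
  have h : star v ᵥ* (hX.eigenvectorUnitary : Matrix n n ℂ) =
      star (star (hX.eigenvectorUnitary : Matrix n n ℂ) *ᵥ v) := by
    rw [star_mulVec, star_eq_conjTranspose, conjTranspose_conjTranspose]
  rw [h, dotProduct, Complex.ofReal_sum]
  refine Finset.sum_congr rfl fun i _ => ?_
  rw [mulVec_diagonal, Complex.ofReal_mul, Complex.normSq_eq_conj_mul_self]
  simp only [Pi.star_apply, Function.comp_apply, Complex.coe_algebraMap, RCLike.star_def]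
  exact mul_left_comm _ _ _

theorem IsHermitian.eigenvalues_mul_self_eq_one {n : Type*} [Fintype n] [DecidableEq n]
    {X : Matrix n n ℂ} (hX : X.IsHermitian) (h : X * X = 1) (i : n) :
    hX.eigenvalues i * hX.eigenvalues i = 1 := by
  have key := congrArg (Unitary.conjStarAlgAut ℂ _ (star hX.eigenvectorUnitary)) h
  rw [map_mul, map_one, hX.conjStarAlgAut_star_eigenvectorUnitary, diagonal_mul_diagonal] at key
  have := congrFun (congrFun key i) i
  simp only [diagonal_apply_eq, one_apply_eq, Function.comp_apply] at this
  exact Complex.ofReal_injective (by simpa using this)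

end Matrix

section HaarMoments

variable {N : ℕ} [MeasurableSpace (unitaryGroup (Fin N) ℂ)] [BorelSpace (unitaryGroup (Fin N) ℂ)]
  (μ : Measure (unitaryGroup (Fin N) ℂ)) [μ.IsHaarMeasure] (ψ : Fin N → ℂ)

theorem integral_comp_mulVec_eq {A : Matrix (Fin N) (Fin N) ℂ} (hA : A ∈ unitaryGroup (Fin N) ℂ)
    (f : (Fin N → ℂ) → ℝ) :
    ∫ U : unitaryGroup (Fin N) ℂ, f (A *ᵥ (U.1 *ᵥ ψ)) ∂μ =
      ∫ U : unitaryGroup (Fin N) ℂ, f (U.1 *ᵥ ψ) ∂μ := by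
  rw [← integral_mul_left_eq_self (fun U : unitaryGroup (Fin N) ℂ => f (U.1 *ᵥ ψ)) ⟨A, hA⟩]
  simp [mulVec_mulVec]

theorem integrable_comp_mulVec {f : (Fin N → ℂ) → ℝ} (hf : Continuous f) :
    Integrable (fun U : unitaryGroup (Fin N) ℂ => f (U.1 *ᵥ ψ)) μ :=
  (hf.comp (continuous_subtype_val.matrix_mulVec continuous_const)).integrable_of_hasCompactSupport
    (HasCompactSupport.of_compactSpace _)

theorem integral_update_mulVec (i : Fin N) {z : ℂ} (hz : star z * z = 1)
    (f : (Fin N → ℂ) → ℝ) :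
    ∫ U : unitaryGroup (Fin N) ℂ,
        f (Function.update (U.1 *ᵥ ψ) i (z * (U.1 *ᵥ ψ) i)) ∂μ =
      ∫ U : unitaryGroup (Fin N) ℂ, f (U.1 *ᵥ ψ) ∂μ := by
  have hmem : 1 + (z - 1) • vecMulVec (Pi.single i 1) (star (Pi.single i 1)) ∈
      unitaryGroup (Fin N) ℂ := by
    apply one_add_smul_vecMulVec_mem_unitaryGroup
    simp only [dotProduct_single, Pi.star_apply, Pi.single_eq_same, star_one, star_sub]
    linear_combination hz
  rw [← integral_comp_mulVec_eq μ ψ hmem]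
  congr! 3 with U
  ext k
  rw [add_mulVec, one_mulVec, smul_mulVec, vecMulVec_mulVec]
  rcases eq_or_ne k i with rfl | hk
  · simp
    ring
  · simp [hk]

/-- The real and imaginary parts of `v i * conj (v j)` have equal second moments. -/
theorem integral_im_mul_sq {i j : Fin N} (hij : i ≠ j) :
    ∫ U : unitaryGroup (Fin N) ℂ, ((U.1 *ᵥ ψ) i * star ((U.1 *ᵥ ψ) j)).im ^ 2 ∂μ =
      (∫ U : unitaryGroup (Fin N) ℂ,
        Complex.normSq ((U.1 *ᵥ ψ) i) * Complex.normSq ((U.1 *ᵥ ψ) j) ∂μ) / 2 := by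
  have h1 := integral_update_mulVec μ ψ i (z := Complex.I) (by simp)
    (fun v => (v i * star (v j)).im ^ 2)
  have h2 : ∀ v : Fin N → ℂ, Complex.normSq (v i) * Complex.normSq (v j) =
      (v i * star (v j)).im ^ 2 + (Complex.I * v i * star (v j)).im ^ 2 := by
    intro v
    simp [Complex.normSq_apply]
    ring
  simp only [Function.update_self, Function.update_of_ne hij.symm] at h1
  simp_rw [h2]
  rw [integral_add (integrable_comp_mulVec μ ψ (f := fun v => (v i * star (v j)).im ^ 2)
      (by fun_prop)) (integrable_comp_mulVec μ ψ
      (f := fun v => (Complex.I * v i * star (v j)).im ^ 2) (by fun_prop)), h1]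
  ring

/-- Invariance under the reflection mixing coordinates `i` and `j` symmetrically. -/
theorem integral_normSq_sq_mix {i j : Fin N} (hij : i ≠ j) :
    4 * ∫ U : unitaryGroup (Fin N) ℂ, Complex.normSq ((U.1 *ᵥ ψ) i) ^ 2 ∂μ =
      ∫ U : unitaryGroup (Fin N) ℂ, Complex.normSq ((U.1 *ᵥ ψ) i) ^ 2 ∂μ +
      ∫ U : unitaryGroup (Fin N) ℂ, Complex.normSq ((U.1 *ᵥ ψ) j) ^ 2 ∂μ +
      4 * ∫ U : unitaryGroup (Fin N) ℂ,
        Complex.normSq ((U.1 *ᵥ ψ) i) * Complex.normSq ((U.1 *ᵥ ψ) j) ∂μ := by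
  have hc : Continuous Complex.normSq := Complex.continuous_normSq
  let u : Fin N → ℂ := Pi.single i 1 - Pi.single j 1
  have hmem : 1 + ((Complex.I - 1) / 2) • vecMulVec u (star u) ∈ unitaryGroup (Fin N) ℂ := by
    apply one_add_smul_vecMulVec_mem_unitaryGroup
    have hu : star u ⬝ᵥ u = 2 := by
      simp [u, dotProduct_sub, hij, hij.symm]
      norm_num
    rw [hu]
    simp
    linear_combination (-(1 : ℂ) / 2) * Complex.I_mul_I
  have hmix : ∀ v : Fin N → ℂ,
      Complex.normSq (((1 + ((Complex.I - 1) / 2) • vecMulVec u (star u)) *ᵥ v) i) =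
        (Complex.normSq (v i) + Complex.normSq (v j)) / 2 - (v i * star (v j)).im := by
    intro v
    rw [add_mulVec, one_mulVec, smul_mulVec, vecMulVec_mulVec]
    simp [u, sub_dotProduct, hij, Complex.normSq_apply]
    ring
  have h1 := integral_comp_mulVec_eq μ ψ hmem (fun v => Complex.normSq (v i) ^ 2)
  have h2 := integral_update_mulVec μ ψ i (z := -1) (by simp)
    (fun v => ((Complex.normSq (v i) + Complex.normSq (v j)) / 2 - (v i * star (v j)).im) ^ 2)
  simp only [hmix] at h1
  simp only [Function.update_self, Function.update_of_ne hij.symm, neg_mul, one_mul,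
    Complex.neg_im, Complex.normSq_neg, sub_neg_eq_add] at h2
  have h3 : ∫ U : unitaryGroup (Fin N) ℂ,
      (((Complex.normSq ((U.1 *ᵥ ψ) i) + Complex.normSq ((U.1 *ᵥ ψ) j)) / 2
        - ((U.1 *ᵥ ψ) i * star ((U.1 *ᵥ ψ) j)).im) ^ 2 +
      ((Complex.normSq ((U.1 *ᵥ ψ) i) + Complex.normSq ((U.1 *ᵥ ψ) j)) / 2
        + ((U.1 *ᵥ ψ) i * star ((U.1 *ᵥ ψ) j)).im) ^ 2) ∂μ =
      ∫ U : unitaryGroup (Fin N) ℂ,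
        (1 / 2 * Complex.normSq ((U.1 *ᵥ ψ) i) ^ 2 + 1 / 2 * Complex.normSq ((U.1 *ᵥ ψ) j) ^ 2 +
        Complex.normSq ((U.1 *ᵥ ψ) i) * Complex.normSq ((U.1 *ᵥ ψ) j) +
        2 * ((U.1 *ᵥ ψ) i * star ((U.1 *ᵥ ψ) j)).im ^ 2) ∂μ := by
    congr 1 with U
    ring
  have hint : ∀ f : (Fin N → ℂ) → ℝ, Continuous f →
      Integrable (fun U : unitaryGroup (Fin N) ℂ => f (U.1 *ᵥ ψ)) μ :=
    fun f hf => integrable_comp_mulVec μ ψ hf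
  rw [integral_add
      (hint (fun v => ((Complex.normSq (v i) + Complex.normSq (v j)) / 2
        - (v i * star (v j)).im) ^ 2) (by fun_prop))
      (hint (fun v => ((Complex.normSq (v i) + Complex.normSq (v j)) / 2
        + (v i * star (v j)).im) ^ 2) (by fun_prop)),
    integral_add
      (hint (fun v => 1 / 2 * Complex.normSq (v i) ^ 2 + 1 / 2 * Complex.normSq (v j) ^ 2 +
        Complex.normSq (v i) * Complex.normSq (v j)) (by fun_prop))
      (hint (fun v => 2 * (v i * star (v j)).im ^ 2) (by fun_prop)),
    integral_add
      (hint (fun v => 1 / 2 * Complex.normSq (v i) ^ 2 + 1 / 2 * Complex.normSq (v j) ^ 2)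
        (by fun_prop))
      (hint (fun v => Complex.normSq (v i) * Complex.normSq (v j)) (by fun_prop)),
    integral_add (hint (fun v => 1 / 2 * Complex.normSq (v i) ^ 2) (by fun_prop))
      (hint (fun v => 1 / 2 * Complex.normSq (v j) ^ 2) (by fun_prop)),
    integral_const_mul, integral_const_mul, integral_const_mul, integral_im_mul_sq μ ψ hij,
    h2, h1] at h3
  linarith

theorem integral_sum_mul_normSq_sq (d : Fin N → ℝ) :
    ∫ U : unitaryGroup (Fin N) ℂ, (∑ i, d i * Complex.normSq ((U.1 *ᵥ ψ) i)) ^ 2 ∂μ =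
      ∑ i, ∑ j, d i * d j * ∫ U : unitaryGroup (Fin N) ℂ,
        Complex.normSq ((U.1 *ᵥ ψ) i) * Complex.normSq ((U.1 *ᵥ ψ) j) ∂μ := by
  have hc : Continuous Complex.normSq := Complex.continuous_normSq
  simp_rw [← integral_const_mul, sq, Finset.sum_mul_sum]
  rw [integral_finsetSum _ fun i _ => integrable_comp_mulVec μ ψ
    (f := fun v => ∑ j, d i * Complex.normSq (v i) * (d j * Complex.normSq (v j))) (by fun_prop)]
  refine Finset.sum_congr rfl fun i _ => ?_
  rw [integral_finsetSum _ fun j _ => integrable_comp_mulVec μ ψ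
    (f := fun v => d i * Complex.normSq (v i) * (d j * Complex.normSq (v j))) (by fun_prop)]
  refine Finset.sum_congr rfl fun j _ => ?_
  congr 1 with U
  ring

variable [IsProbabilityMeasure μ] {ψ}

/-- Fourth absolute moments of a Haar-random unit vector. -/
theorem integral_normSq_mul_normSq (hψ : star ψ ⬝ᵥ ψ = 1) (i j : Fin N) :
    ∫ U : unitaryGroup (Fin N) ℂ,
        Complex.normSq ((U.1 *ᵥ ψ) i) * Complex.normSq ((U.1 *ᵥ ψ) j) ∂μ =
      (1 + if i = j then 1 else 0) / (N * (N + 1)) := by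
  set G : Fin N → Fin N → ℝ := fun i j => ∫ U : unitaryGroup (Fin N) ℂ,
    Complex.normSq ((U.1 *ᵥ ψ) i) * Complex.normSq ((U.1 *ᵥ ψ) j) ∂μ with hG
  have hmix : ∀ {k l}, k ≠ l → G k k = G l l ∧ 2 * G k l = G k k := by
    intro k l hkl
    have h1 := integral_normSq_sq_mix μ ψ hkl
    have h2 := integral_normSq_sq_mix μ ψ hkl.symm
    simp only [mul_comm (Complex.normSq ((_ : Fin N → ℂ) l)) (Complex.normSq (_ : ℂ)), sq] at h1 h2
    constructor <;> simp only [hG] <;> linarith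
  have hdiag : ∀ k, G k k = G i i := by
    intro k
    by_cases h : k = i
    · rw [h]
    · exact (hmix h).1
  have hG2 : ∀ k l, G k l = G i i / 2 * (1 + if k = l then 1 else 0) := by
    intro k l
    split_ifs with h
    · subst h
      rw [hdiag]
      ring
    · linarith [(hmix h).2, hdiag k]
  have hsum : ∑ k, ∑ l, G k l = 1 := by
    have h := integral_sum_mul_normSq_sq μ ψ (fun _ => 1)
    simp only [one_mul, sum_normSq_mulVec hψ, one_pow, integral_const, probReal_univ,
      smul_eq_mul] at h
    exact h.symm
  have hN : (N : ℝ) ≠ 0 := by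
    have := i.pos
    positivity
  have hi : G i i / 2 * (N * (N + 1)) = 1 := by
    refine Eq.trans ?_ hsum
    rw [Finset.sum_congr rfl fun k _ => Finset.sum_congr rfl fun l _ => hG2 k l]
    simp_rw [← Finset.mul_sum, Finset.sum_add_distrib, Finset.sum_ite_eq, Finset.mem_univ,
      if_true, Finset.sum_const, Finset.card_univ, Fintype.card_fin, nsmul_eq_mul]
    ring
  change G i j = _
  rw [hG2, eq_div_iff (by positivity)]
  linear_combination (1 + if i = j then (1 : ℝ) else 0) * hi

/-- Second absolute moments of a Haar-random unit vector. -/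
theorem integral_normSq (hψ : star ψ ⬝ᵥ ψ = 1) (i : Fin N) :
    ∫ U : unitaryGroup (Fin N) ℂ, Complex.normSq ((U.1 *ᵥ ψ) i) ∂μ = 1 / N := by
  have hc : Continuous Complex.normSq := Complex.continuous_normSq
  have h : ∀ U : unitaryGroup (Fin N) ℂ, Complex.normSq ((U.1 *ᵥ ψ) i) =
      ∑ j, Complex.normSq ((U.1 *ᵥ ψ) i) * Complex.normSq ((U.1 *ᵥ ψ) j) := by
    intro U
    rw [← Finset.mul_sum, sum_normSq_mulVec hψ, mul_one]
  rw [integral_congr_ae (.of_forall h), integral_finsetSum _ fun j _ => integrable_comp_mulVec μ ψ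
    (f := fun v => Complex.normSq (v i) * Complex.normSq (v j)) (by fun_prop)]
  have hN : (N : ℝ) ≠ 0 := by
    have := i.pos
    positivity
  simp_rw [integral_normSq_mul_normSq μ hψ, ← Finset.sum_div, Finset.sum_add_distrib]
  simp
  field_simp

/-- Mean of the quadratic form of a Hermitian matrix at a Haar-random unit vector. -/
theorem integral_quadraticForm (hψ : star ψ ⬝ᵥ ψ = 1) {A : Matrix (Fin N) (Fin N) ℂ}
    (hA : A.IsHermitian) :
    ∫ U : unitaryGroup (Fin N) ℂ, (star (U.1 *ᵥ ψ) ⬝ᵥ (A *ᵥ (U.1 *ᵥ ψ))).re ∂μ =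
      A.trace.re / N := by
  have hc : Continuous Complex.normSq := Complex.continuous_normSq
  simp_rw [hA.star_dotProduct_mulVec_eq, Complex.ofReal_re]
  rw [integral_comp_mulVec_eq μ ψ (Unitary.star_mem hA.eigenvectorUnitary.2)
      (fun v => ∑ i, hA.eigenvalues i * Complex.normSq (v i)),
    integral_finsetSum _ fun i _ => integrable_comp_mulVec μ ψ
      (f := fun v => hA.eigenvalues i * Complex.normSq (v i)) (by fun_prop)]
  simp_rw [integral_const_mul, integral_normSq μ hψ, ← Finset.sum_mul]
  rw [hA.trace_eq_sum_eigenvalues]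
  simp [div_eq_mul_inv]

/-- Second moment of the quadratic form of a traceless Hermitian involution at a Haar-random
unit vector. -/
theorem integral_quadraticForm_sq (hN : N ≠ 0) (hψ : star ψ ⬝ᵥ ψ = 1)
    {X : Matrix (Fin N) (Fin N) ℂ} (hX : X.IsHermitian) (htr : X.trace = 0) (hX2 : X * X = 1) :
    ∫ U : unitaryGroup (Fin N) ℂ, (star (U.1 *ᵥ ψ) ⬝ᵥ (X *ᵥ (U.1 *ᵥ ψ))).re ^ 2 ∂μ =
      1 / (N + 1) := by
  have hsum : ∑ i, hX.eigenvalues i = 0 := by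
    have h := hX.trace_eq_sum_eigenvalues
    rw [htr] at h
    apply Complex.ofReal_injective
    simpa using h.symm
  simp_rw [hX.star_dotProduct_mulVec_eq, Complex.ofReal_re]
  rw [integral_comp_mulVec_eq μ ψ (Unitary.star_mem hX.eigenvectorUnitary.2)
      (fun v => (∑ i, hX.eigenvalues i * Complex.normSq (v i)) ^ 2),
    integral_sum_mul_normSq_sq]
  simp_rw [integral_normSq_mul_normSq μ hψ, ← mul_div_assoc, ← Finset.sum_div, mul_add,
    Finset.sum_add_distrib, mul_one, ← Finset.mul_sum, hsum, mul_ite, mul_one, mul_zero,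
    Finset.sum_ite_eq, Finset.mem_univ, if_true, hX.eigenvalues_mul_self_eq_one hX2]
  simp
  field_simp

theorem integral_re_dotProduct_sq (hψ : star ψ ⬝ᵥ ψ = 1) {c : Fin N → ℂ}
    (hc : star c ⬝ᵥ c = 1) :
    ∫ U : unitaryGroup (Fin N) ℂ, (star c ⬝ᵥ (U.1 *ᵥ ψ)).re ^ 2 ∂μ = 1 / (2 * N) := by
  have hA : (vecMulVec c (star c)).IsHermitian := by
    rw [IsHermitian, conjTranspose_vecMulVec, star_star]
  have h1 := integral_quadraticForm μ hψ hA
  have h2 := integral_comp_mulVec_eq μ ψ (smul_one_mem_unitaryGroup (z := Complex.I) (by simp))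
    (fun v => (star c ⬝ᵥ v).re ^ 2)
  have hq : ∀ v : Fin N → ℂ, (star v ⬝ᵥ (vecMulVec c (star c) *ᵥ v)).re =
      (star c ⬝ᵥ v).re ^ 2 + (star c ⬝ᵥ v).im ^ 2 := by
    intro v
    rw [vecMulVec_mulVec, dotProduct_smul, star_dotProduct v c]
    simp
    ring
  simp only [smul_mulVec, one_mulVec, dotProduct_smul, smul_eq_mul, Complex.I_mul_re,
    neg_sq] at h2
  simp_rw [hq] at h1
  rw [integral_add
    (integrable_comp_mulVec μ ψ (f := fun v => (star c ⬝ᵥ v).re ^ 2) (by fun_prop))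
    (integrable_comp_mulVec μ ψ (f := fun v => (star c ⬝ᵥ v).im ^ 2) (by fun_prop)), h2,
    trace_vecMulVec, dotProduct_comm, hc] at h1
  rw [mul_comm (2 : ℝ), ← div_div]
  simp at h1 ⊢
  linarith

/-- The cross term has odd degree, so it averages out. -/
theorem integral_re_dotProduct_sub_mul_sq (hN : N ≠ 0) (hψ : star ψ ⬝ᵥ ψ = 1) {c : Fin N → ℂ}
    (hc : star c ⬝ᵥ c = 1) {X : Matrix (Fin N) (Fin N) ℂ} (hX : X.IsHermitian)
    (htr : X.trace = 0) (hX2 : X * X = 1) (r : ℝ) :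
    ∫ U : unitaryGroup (Fin N) ℂ, ((star c ⬝ᵥ (U.1 *ᵥ ψ)).re -
        r * (star (U.1 *ᵥ ψ) ⬝ᵥ (X *ᵥ (U.1 *ᵥ ψ))).re) ^ 2 ∂μ =
      1 / (2 * N) + r ^ 2 * (1 / (N + 1)) := by
  have hq : Continuous fun v : Fin N → ℂ => star v ⬝ᵥ (X *ᵥ v) := by fun_prop
  set f : (Fin N → ℂ) → ℝ := fun v =>
    ((star c ⬝ᵥ v).re - r * (star v ⬝ᵥ (X *ᵥ v)).re) ^ 2
  set g : (Fin N → ℂ) → ℝ := fun v =>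
    ((star c ⬝ᵥ v).re + r * (star v ⬝ᵥ (X *ᵥ v)).re) ^ 2
  have hneg := integral_comp_mulVec_eq μ ψ (smul_one_mem_unitaryGroup (z := -1) (by simp)) f
  have hfg : ∀ v : Fin N → ℂ, f (((-1 : ℂ) • (1 : Matrix (Fin N) (Fin N) ℂ)) *ᵥ v) = g v := by
    intro v
    simp only [f, g, neg_smul, one_smul, neg_mulVec, one_mulVec, mulVec_neg, star_neg,
      dotProduct_neg, neg_dotProduct, neg_neg, Complex.neg_re]
    ring
  simp only [hfg] at hneg
  have hsum : ∫ U : unitaryGroup (Fin N) ℂ, (f (U.1 *ᵥ ψ) + g (U.1 *ᵥ ψ)) ∂μ =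
      ∫ U : unitaryGroup (Fin N) ℂ, (2 * (star c ⬝ᵥ (U.1 *ᵥ ψ)).re ^ 2 +
        2 * r ^ 2 * (star (U.1 *ᵥ ψ) ⬝ᵥ (X *ᵥ (U.1 *ᵥ ψ))).re ^ 2) ∂μ := by
    congr 1 with U
    simp only [f, g]
    ring
  rw [integral_add (integrable_comp_mulVec μ ψ (f := f) (by fun_prop))
      (integrable_comp_mulVec μ ψ (f := g) (by fun_prop)),
    integral_add
      (integrable_comp_mulVec μ ψ (f := fun v => 2 * (star c ⬝ᵥ v).re ^ 2) (by fun_prop))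
      (integrable_comp_mulVec μ ψ
        (f := fun v => 2 * r ^ 2 * (star v ⬝ᵥ (X *ᵥ v)).re ^ 2) (by fun_prop)),
    integral_const_mul, integral_const_mul, hneg, integral_re_dotProduct_sq μ hψ hc,
    integral_quadraticForm_sq μ hN hψ hX htr hX2] at hsum
  linarith

end HaarMoments

/-- **Haar variance of an off-diagonal Fubini–Study metric element.**
Let `U₁, U₂, U₃, U₄` be independent Haar-distributed unitaries (expectation realized as the
iterated integral against the Haar probability measure `μ`), `ψ₀` a unit vector, and `X`
Hermitian with `Tr X = 0` and `X² = I`.  With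
`T = ⟨ψ₀, U₁* X U₂* U₃ X U₄ ψ₀⟩` and `P = ⟨ψ₀, U₁* X U₁ ψ₀⟩ ⟨ψ₀, U₄* X U₄ ψ₀⟩`, the
off-diagonal metric element `g = Re T - P` satisfies `E[g²] = 1/(2N) + 1/(N+1)²`. -/
theorem haar_variance_offdiagonal_fubini_study
    {N : ℕ} (hN : 2 ≤ N)
    [MeasurableSpace (Matrix.unitaryGroup (Fin N) ℂ)]
    [BorelSpace (Matrix.unitaryGroup (Fin N) ℂ)]
    (μ : Measure (Matrix.unitaryGroup (Fin N) ℂ))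
    [μ.IsHaarMeasure] [IsProbabilityMeasure μ]
    (ψ₀ : Fin N → ℂ) (hψ₀ : star ψ₀ ⬝ᵥ ψ₀ = 1)
    (X : Matrix (Fin N) (Fin N) ℂ) (hX : X.IsHermitian) (htr : X.trace = 0)
    (hX2 : X * X = 1) :
    (∫ U₁ : Matrix.unitaryGroup (Fin N) ℂ,
      ∫ U₂ : Matrix.unitaryGroup (Fin N) ℂ,
        ∫ U₃ : Matrix.unitaryGroup (Fin N) ℂ,
          ∫ U₄ : Matrix.unitaryGroup (Fin N) ℂ,
            (let T := star ψ₀ ⬝ᵥ (((U₁ : Matrix (Fin N) (Fin N) ℂ)ᴴ * X *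
                (U₂ : Matrix (Fin N) (Fin N) ℂ)ᴴ * (U₃ : Matrix (Fin N) (Fin N) ℂ) * X *
                (U₄ : Matrix (Fin N) (Fin N) ℂ)).mulVec ψ₀)
             let P := ((star ψ₀ ⬝ᵥ (((U₁ : Matrix (Fin N) (Fin N) ℂ)ᴴ * X *
                (U₁ : Matrix (Fin N) (Fin N) ℂ)).mulVec ψ₀)) *
                (star ψ₀ ⬝ᵥ (((U₄ : Matrix (Fin N) (Fin N) ℂ)ᴴ * X *
                (U₄ : Matrix (Fin N) (Fin N) ℂ)).mulVec ψ₀))).re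
             (T.re - P) ^ 2) ∂μ ∂μ ∂μ ∂μ)
      = 1 / (2 * (N : ℝ)) + 1 / ((N : ℝ) + 1) ^ 2 := by
  have hN0 : N ≠ 0 := by omega
  have hXU : X ∈ unitaryGroup (Fin N) ℂ := by
    rw [mem_unitaryGroup_iff', star_eq_conjTranspose, hX.eq, hX2]
  have hquad : ∀ U : unitaryGroup (Fin N) ℂ,
      star ψ₀ ⬝ᵥ ((U.1ᴴ * X * U.1) *ᵥ ψ₀) = star (U.1 *ᵥ ψ₀) ⬝ᵥ (X *ᵥ (U.1 *ᵥ ψ₀)) := by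
    intro U
    rw [star_mulVec, ← dotProduct_mulVec, mulVec_mulVec, mulVec_mulVec, mul_assoc]
  have him : ∀ v : Fin N → ℂ, (star v ⬝ᵥ (X *ᵥ v)).im = 0 := by
    intro v
    rw [hX.star_dotProduct_mulVec_eq, Complex.ofReal_im]
  have hinner : ∀ U₁ U₂ U₃ : unitaryGroup (Fin N) ℂ,
      ∫ U₄ : unitaryGroup (Fin N) ℂ,
        ((star ψ₀ ⬝ᵥ ((U₁.1ᴴ * X * U₂.1ᴴ * U₃.1 * X * U₄.1) *ᵥ ψ₀)).re -
          ((star ψ₀ ⬝ᵥ ((U₁.1ᴴ * X * U₁.1) *ᵥ ψ₀)) *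
            (star ψ₀ ⬝ᵥ ((U₄.1ᴴ * X * U₄.1) *ᵥ ψ₀))).re) ^ 2 ∂μ =
      1 / (2 * N) + (star (U₁.1 *ᵥ ψ₀) ⬝ᵥ (X *ᵥ (U₁.1 *ᵥ ψ₀))).re ^ 2 * (1 / (N + 1)) := by
    intro U₁ U₂ U₃
    have hW : U₁.1ᴴ * X * U₂.1ᴴ * U₃.1 * X ∈ unitaryGroup (Fin N) ℂ :=
      mul_mem (mul_mem (mul_mem (mul_mem (star U₁).2 hXU) (star U₂).2) U₃.2) hXU
    set W := U₁.1ᴴ * X * U₂.1ᴴ * U₃.1 * X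
    have hc : star (Wᴴ *ᵥ ψ₀) ⬝ᵥ (Wᴴ *ᵥ ψ₀) = 1 := by
      exact (star_dotProduct_mulVec_unitary (Unitary.star_mem hW) ψ₀).trans hψ₀
    have hT : ∀ v : Fin N → ℂ, star ψ₀ ⬝ᵥ (W *ᵥ v) = star (Wᴴ *ᵥ ψ₀) ⬝ᵥ v := by
      intro v
      rw [star_mulVec, conjTranspose_conjTranspose, ← dotProduct_mulVec]
    rw [← integral_re_dotProduct_sub_mul_sq μ hN0 hψ₀ hc hX htr hX2]
    congr 1 with U₄
    rw [← mulVec_mulVec ψ₀ W, hT, hquad, hquad, Complex.mul_re, him, zero_mul, sub_zero]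
  simp only [hinner, integral_const, probReal_univ, one_smul]
  rw [integral_add (integrable_const _) (integrable_comp_mulVec μ ψ₀
      (f := fun v => (star v ⬝ᵥ (X *ᵥ v)).re ^ 2 * (1 / (N + 1))) (by fun_prop)),
    integral_mul_const, integral_quadraticForm_sq μ hN0 hψ₀ hX htr hX2, integral_const,
    probReal_univ, one_smul]
  field_simp
end

section
/- Let N ≥ 1, let U₁, U₂, U₃, U₄ be independent Haar-distributed random elements of U(N), let ψ₀ ∈ ℂ^N be a unit vector, and let X be an N×N Hermitian matrix with X² = I. Then E[ |⟨ψ₀, U₁* X U₂* U₃ X U₄ ψ₀⟩|² ] = 1/N. -/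
open MeasureTheory Matrix

namespace HaarUnitary

variable {N : ℕ}

theorem norm_mulVec_apply_le (U : Matrix.unitaryGroup (Fin N) ℂ) (v : Fin N → ℂ) (i : Fin N) :
    ‖((U : Matrix (Fin N) (Fin N) ℂ) *ᵥ v) i‖ ≤ ∑ k, ‖v k‖ := by
  rw [mulVec, dotProduct]
  refine (norm_sum_le _ _).trans (Finset.sum_le_sum fun k _ => ?_)
  rw [norm_mul]
  exact mul_le_of_le_one_left (norm_nonneg _) (entry_norm_bound_of_unitary U.2 i k)

theorem star_dotProduct_mulVec_self (U : Matrix.unitaryGroup (Fin N) ℂ) (v : Fin N → ℂ) :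
    ∑ i, ((U : Matrix (Fin N) (Fin N) ℂ) *ᵥ v) i * star (((U : Matrix (Fin N) (Fin N) ℂ) *ᵥ v) i)
      = star v ⬝ᵥ v := by
  change ((U : Matrix (Fin N) (Fin N) ℂ) *ᵥ v) ⬝ᵥ star ((U : Matrix (Fin N) (Fin N) ℂ) *ᵥ v) = _
  rw [dotProduct_comm, star_mulVec, dotProduct_mulVec, vecMul_vecMul, ← star_eq_conjTranspose,
    mem_unitaryGroup_iff'.mp U.2, vecMul_one]

variable [MeasurableSpace (Matrix.unitaryGroup (Fin N) ℂ)]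
  [BorelSpace (Matrix.unitaryGroup (Fin N) ℂ)]
  (μ : Measure (Matrix.unitaryGroup (Fin N) ℂ))

theorem integrable_mulVec_mul_star [IsFiniteMeasure μ] (v : Fin N → ℂ) (i j : Fin N) :
    Integrable (fun U : Matrix.unitaryGroup (Fin N) ℂ =>
      ((U : Matrix (Fin N) (Fin N) ℂ) *ᵥ v) i *
        star (((U : Matrix (Fin N) (Fin N) ℂ) *ᵥ v) j)) μ := by
  have hc (k : Fin N) : Continuous fun U : Matrix.unitaryGroup (Fin N) ℂ =>
      ((U : Matrix (Fin N) (Fin N) ℂ) *ᵥ v) k :=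
    (continuous_apply k).comp (continuous_subtype_val.matrix_mulVec continuous_const)
  refine Integrable.of_bound ((hc i).mul (hc j).star).aestronglyMeasurable
    ((∑ k, ‖v k‖) * ∑ k, ‖v k‖) (Filter.Eventually.of_forall fun U => ?_)
  rw [norm_mul, norm_star]
  exact mul_le_mul (norm_mulVec_apply_le U v i) (norm_mulVec_apply_le U v j) (norm_nonneg _)
    (Finset.sum_nonneg fun k _ => norm_nonneg _)

theorem integral_mulVec_mul_star_of_ne [μ.IsMulLeftInvariant] (v : Fin N → ℂ) {i j : Fin N}
    (hij : i ≠ j) :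
    ∫ U : Matrix.unitaryGroup (Fin N) ℂ, ((U : Matrix (Fin N) (Fin N) ℂ) *ᵥ v) i *
      star (((U : Matrix (Fin N) (Fin N) ℂ) *ᵥ v) j) ∂μ = 0 := by
  set d : Fin N → ℂ := fun k => if k = i then -1 else 1 with hd
  have hD : diagonal d ∈ Matrix.unitaryGroup (Fin N) ℂ := by
    rw [mem_unitaryGroup_iff, star_eq_conjTranspose, diagonal_conjTranspose, diagonal_mul_diagonal,
      ← diagonal_one]
    congr 1
    funext k
    by_cases hk : k = i <;> simp [hd, hk]
  have h := integral_mul_left_eq_self (μ := μ) (fun U : Matrix.unitaryGroup (Fin N) ℂ =>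
    ((U : Matrix (Fin N) (Fin N) ℂ) *ᵥ v) i * star (((U : Matrix (Fin N) (Fin N) ℂ) *ᵥ v) j))
    ⟨diagonal d, hD⟩
  simp only [Submonoid.coe_mul, ← mulVec_mulVec, mulVec_diagonal, hd, if_pos, if_neg hij.symm,
    one_mul, neg_mul, integral_neg] at h
  exact self_eq_neg.mp h.symm

theorem integral_mulVec_mul_star_self_eq [μ.IsMulLeftInvariant] (v : Fin N → ℂ) (i j : Fin N) :
    ∫ U : Matrix.unitaryGroup (Fin N) ℂ, ((U : Matrix (Fin N) (Fin N) ℂ) *ᵥ v) i *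
      star (((U : Matrix (Fin N) (Fin N) ℂ) *ᵥ v) i) ∂μ =
    ∫ U : Matrix.unitaryGroup (Fin N) ℂ, ((U : Matrix (Fin N) (Fin N) ℂ) *ᵥ v) j *
      star (((U : Matrix (Fin N) (Fin N) ℂ) *ᵥ v) j) ∂μ := by
  set P : Matrix (Fin N) (Fin N) ℂ := (Equiv.swap i j).permMatrix ℂ with hPdef
  have hP : P ∈ Matrix.unitaryGroup (Fin N) ℂ := by
    rw [mem_unitaryGroup_iff, star_eq_conjTranspose, hPdef, conjTranspose_permMatrix,
      ← permMatrix_mul]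
    simp
  have h := integral_mul_left_eq_self (μ := μ) (fun U : Matrix.unitaryGroup (Fin N) ℂ =>
    ((U : Matrix (Fin N) (Fin N) ℂ) *ᵥ v) j * star (((U : Matrix (Fin N) (Fin N) ℂ) *ᵥ v) j))
    ⟨P, hP⟩
  simpa [← mulVec_mulVec, hPdef, permMatrix_mulVec] using h

/-- The second moment of the orbit of a vector under a left-invariant probability measure on the
unitary group is a multiple of the identity. -/
theorem integral_mulVec_mul_star [μ.IsMulLeftInvariant] [IsProbabilityMeasure μ]
    (v : Fin N → ℂ) (i j : Fin N) :
    ∫ U : Matrix.unitaryGroup (Fin N) ℂ, ((U : Matrix (Fin N) (Fin N) ℂ) *ᵥ v) i *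
      star (((U : Matrix (Fin N) (Fin N) ℂ) *ᵥ v) j) ∂μ =
    if i = j then (star v ⬝ᵥ v) / N else 0 := by
  split_ifs with hij
  · subst hij
    have hN : (N : ℂ) ≠ 0 := Nat.cast_ne_zero.mpr (Fin.pos i).ne'
    have h := integral_finsetSum (μ := μ) Finset.univ
      fun k _ => integrable_mulVec_mul_star μ v k k
    simp only [star_dotProduct_mulVec_self, integral_const, probReal_univ, one_smul,
      integral_mulVec_mul_star_self_eq μ v _ i, Finset.sum_const, Finset.card_univ,
      Fintype.card_fin, nsmul_eq_mul] at h
    rw [h, mul_div_cancel_left₀ _ hN]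
  · exact integral_mulVec_mul_star_of_ne μ v hij

theorem integral_norm_sq_dotProduct_mulVec [μ.IsMulLeftInvariant] [IsProbabilityMeasure μ]
    (a v : Fin N → ℂ) :
    ((∫ U : Matrix.unitaryGroup (Fin N) ℂ,
      ‖star a ⬝ᵥ (U : Matrix (Fin N) (Fin N) ℂ) *ᵥ v‖ ^ 2 ∂μ : ℝ) : ℂ) =
    (star a ⬝ᵥ a) * (star v ⬝ᵥ v) / N := by
  have hexp (U : Matrix.unitaryGroup (Fin N) ℂ) :
      ((‖star a ⬝ᵥ (U : Matrix (Fin N) (Fin N) ℂ) *ᵥ v‖ ^ 2 : ℝ) : ℂ) =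
      ∑ i, ∑ j, (star (a i) * a j) * (((U : Matrix (Fin N) (Fin N) ℂ) *ᵥ v) i *
        star (((U : Matrix (Fin N) (Fin N) ℂ) *ᵥ v) j)) := by
    rw [Complex.ofReal_pow, ← Complex.mul_conj', starRingEnd_apply, dotProduct, star_sum,
      Finset.sum_mul_sum]
    refine Finset.sum_congr rfl fun i _ => Finset.sum_congr rfl fun j _ => ?_
    simp only [Pi.star_apply, star_mul', star_star]
    ring
  have hint (i j : Fin N) := (integrable_mulVec_mul_star μ v i j).const_mul (star (a i) * a j)
  rw [← integral_complex_ofReal]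
  simp only [hexp]
  rw [integral_finsetSum _ fun i _ => integrable_finsetSum _ fun j _ => hint i j]
  simp only [integral_finsetSum _ fun j _ => hint _ j, integral_const_mul,
    integral_mulVec_mul_star, mul_ite, mul_zero, Finset.sum_ite_eq, Finset.mem_univ, if_true]
  rw [← Finset.sum_mul, mul_div_assoc]
  rfl

end HaarUnitary

/-- **Haar average of the squared cross term.**
Let `U₁, U₂, U₃, U₄` be independent Haar-distributed unitaries (expectation realized as the
iterated integral against the Haar probability measure `μ`), `ψ₀` a unit vector, and `X`
Hermitian with `X² = I`.  Then `E[|⟨ψ₀, U₁* X U₂* U₃ X U₄ ψ₀⟩|²] = 1/N`. -/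
theorem haar_average_cross_term_sq
    {N : ℕ} (hN : 1 ≤ N)
    [MeasurableSpace (Matrix.unitaryGroup (Fin N) ℂ)]
    [BorelSpace (Matrix.unitaryGroup (Fin N) ℂ)]
    (μ : Measure (Matrix.unitaryGroup (Fin N) ℂ))
    [μ.IsHaarMeasure] [IsProbabilityMeasure μ]
    (ψ₀ : Fin N → ℂ) (hψ₀ : star ψ₀ ⬝ᵥ ψ₀ = 1)
    (X : Matrix (Fin N) (Fin N) ℂ) (hX : X.IsHermitian) (hX2 : X * X = 1) :
    (∫ U₁ : Matrix.unitaryGroup (Fin N) ℂ,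
      ∫ U₂ : Matrix.unitaryGroup (Fin N) ℂ,
        ∫ U₃ : Matrix.unitaryGroup (Fin N) ℂ,
          ∫ U₄ : Matrix.unitaryGroup (Fin N) ℂ,
            ‖star ψ₀ ⬝ᵥ (((U₁ : Matrix (Fin N) (Fin N) ℂ)ᴴ * X *
                (U₂ : Matrix (Fin N) (Fin N) ℂ)ᴴ * (U₃ : Matrix (Fin N) (Fin N) ℂ) * X *
                (U₄ : Matrix (Fin N) (Fin N) ℂ)).mulVec ψ₀)‖ ^ 2 ∂μ ∂μ ∂μ ∂μ)
      = 1 / (N : ℝ) := by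
  have hXU : X ∈ Matrix.unitaryGroup (Fin N) ℂ := by
    rw [mem_unitaryGroup_iff, star_eq_conjTranspose, hX.eq, hX2]
  have hψ : ∫ U : Matrix.unitaryGroup (Fin N) ℂ,
      ‖star ψ₀ ⬝ᵥ (U : Matrix (Fin N) (Fin N) ℂ) *ᵥ ψ₀‖ ^ 2 ∂μ = 1 / (N : ℝ) := by
    have h := HaarUnitary.integral_norm_sq_dotProduct_mulVec μ ψ₀ ψ₀
    rw [hψ₀, one_mul] at h
    exact Complex.ofReal_injective (by rw [h]; push_cast; rfl)
  have hinner (U₁ U₂ U₃ : Matrix.unitaryGroup (Fin N) ℂ) :=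
    (integral_mul_left_eq_self (μ := μ) (fun U : Matrix.unitaryGroup (Fin N) ℂ =>
      ‖star ψ₀ ⬝ᵥ (U : Matrix (Fin N) (Fin N) ℂ) *ᵥ ψ₀‖ ^ 2)
      (star U₁ * ⟨X, hXU⟩ * star U₂ * U₃ * ⟨X, hXU⟩)).trans hψ
  simp only [Submonoid.coe_mul, Unitary.coe_star, star_eq_conjTranspose] at hinner
  simp only [hinner, integral_const, probReal_univ, one_smul]
end

section
/- Let η > 0 and λ > 0 be constants, and let ε, K : [0,∞) → ℝ be differentiable functions satisfying the coupled dynamics dε/dt = −η·K(t) and dK/dt = −2ηλ·K(t) for all t ≥ 0, together with ε(t) → 0 as t → ∞. Then K(t) = K(0)·exp(−2ηλ t) for all t ≥ 0, and the residual error is locked to the kernel by 2λ·ε(t) = K(t) for all t ≥ 0; in particular ε(t) = (K(0)/(2λ))·exp(−2ηλ t). -/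
open Filter

/-- A function with vanishing derivative on `[0, ∞)` is constant there. -/
theorem eq_apply_zero_of_hasDerivAt_zero {f : ℝ → ℝ} (hf : ∀ t : ℝ, 0 ≤ t → HasDerivAt f 0 t)
    {t : ℝ} (ht : 0 ≤ t) : f t = f 0 :=
  constant_of_has_deriv_right_zero
    (fun x hx => (hf x hx.1).continuousAt.continuousWithinAt)
    (fun x hx => (hf x hx.1).hasDerivWithinAt) t ⟨ht, le_rfl⟩

/-- Solutions of `f' = -(c f)` on `[0, ∞)` are exponentials. -/
theorem eq_mul_exp_of_hasDerivAt {f : ℝ → ℝ} {c : ℝ}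
    (hf : ∀ t : ℝ, 0 ≤ t → HasDerivAt f (-(c * f t)) t) {t : ℝ} (ht : 0 ≤ t) :
    f t = f 0 * Real.exp (-(c * t)) := by
  have hconst : f t * Real.exp (c * t) = f 0 * Real.exp (c * 0) := by
    refine eq_apply_zero_of_hasDerivAt_zero (f := fun s => f s * Real.exp (c * s))
      (fun s hs => ?_) ht
    refine ((hf s hs).mul ((hasDerivAt_id s).const_mul c).exp).congr_deriv ?_
    simp only [id]
    ring
  rw [mul_zero, Real.exp_zero, mul_one] at hconst
  rw [← hconst, mul_assoc, ← Real.exp_add, add_neg_cancel, Real.exp_zero, mul_one]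

/-- **Continuous-time linear-loss dynamics: kernel decay and error locking.**
If `dε/dt = -η K(t)` and `dK/dt = -2ηλ K(t)` for `t ≥ 0`, with `η, λ > 0` and `ε(t) → 0`
as `t → ∞`, then `K(t) = K(0) exp(-2ηλ t)`, the residual error is locked to the kernel via
`2λ ε(t) = K(t)`, and in particular `ε(t) = (K(0)/(2λ)) exp(-2ηλ t)` for all `t ≥ 0`. -/
theorem linear_loss_continuous_dynamics
    (η lam : ℝ) (hη : 0 < η) (hlam : 0 < lam)
    (ε K : ℝ → ℝ)
    (hε : ∀ t : ℝ, 0 ≤ t → HasDerivAt ε (-(η * K t)) t)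
    (hK : ∀ t : ℝ, 0 ≤ t → HasDerivAt K (-(2 * η * lam * K t)) t)
    (hlim : Tendsto ε atTop (nhds 0)) :
    ∀ t : ℝ, 0 ≤ t →
      K t = K 0 * Real.exp (-(2 * η * lam * t)) ∧
      2 * lam * ε t = K t ∧
      ε t = K 0 / (2 * lam) * Real.exp (-(2 * η * lam * t)) := by
  have hKexp : ∀ t : ℝ, 0 ≤ t → K t = K 0 * Real.exp (-(2 * η * lam * t)) :=
    fun t ht => eq_mul_exp_of_hasDerivAt hK ht
  have hconst : ∀ t : ℝ, 0 ≤ t → 2 * lam * ε t - K t = 2 * lam * ε 0 - K 0 := by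
    intro t ht
    refine eq_apply_zero_of_hasDerivAt_zero (f := fun s => 2 * lam * ε s - K s)
      (fun s hs => ?_) ht
    refine (((hε s hs).const_mul (2 * lam)).sub (hK s hs)).congr_deriv ?_
    ring
  have hKlim : Tendsto K atTop (nhds 0) := by
    have hexp : Tendsto (fun t : ℝ => K 0 * Real.exp (-(2 * η * lam * t))) atTop (nhds 0) := by
      have hlin : Tendsto (fun t : ℝ => 2 * η * lam * t) atTop atTop :=
        tendsto_id.const_mul_atTop (by positivity)
      simpa using (Real.tendsto_exp_neg_atTop_nhds_zero.comp hlin).const_mul (K 0)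
    refine hexp.congr' ?_
    filter_upwards [eventually_ge_atTop 0] with t ht using (hKexp t ht).symm
  have hzero : 2 * lam * ε 0 - K 0 = 0 := by
    have hdiff : Tendsto (fun t => 2 * lam * ε t - K t) atTop (nhds 0) := by
      simpa using (hlim.const_mul (2 * lam)).sub hKlim
    refine tendsto_nhds_unique (tendsto_const_nhds.congr' ?_) hdiff
    filter_upwards [eventually_ge_atTop 0] with t ht using (hconst t ht).symm
  intro t ht
  have hlock : 2 * lam * ε t = K t := by linarith [hconst t ht]
  refine ⟨hKexp t ht, hlock, ?_⟩
  rw [div_mul_eq_mul_div, ← hKexp t ht, ← hlock]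
  field_simp
end
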